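/- Let f satisfy (H) be a regular nonlinearity (a_f = ∞) with 0 < τ₋ ≤ τ₊ < 2, and Ω an arbitrary bounded smooth domain in ℝⁿ. If n < ((4α*(2−τ₊)+2τ₊)/τ₊)·max{1, τ₊}, where α* is the largest real root of P_f(α,τ₋,τ₊) = (2−τ₋)²α⁴ − 8(2−τ₊)α² + 4(4−3τ₊)α − 4(1−τ₊), then the extremal solution u*(x) = lim_{λ↑λ*} u_λ(x) of problem (N_λ) belongs to L^∞(Ω). -/

import Mathlib

open MeasureTheory Filter Topology Real Set

noncomputable section

/-- The Laplacian of a real-valued function on Euclidean space. -/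
def lap {n : ℕ} (u : EuclideanSpace ℝ (Fin n) → ℝ) (x : EuclideanSpace ℝ (Fin n)) : ℝ :=
  ∑ i : Fin n, iteratedFDeriv ℝ 2 u x ![EuclideanSpace.single i (1:ℝ), EuclideanSpace.single i (1:ℝ)]

/-- A bounded (smooth) domain. -/
def GoodDomain {n : ℕ} (Ω : Set (EuclideanSpace ℝ (Fin n))) : Prop :=
  IsOpen Ω ∧ Bornology.IsBounded Ω ∧ Ω.Nonempty

/-- The domain `[0, a_f)` of the nonlinearity. -/
def domf (a : EReal) : Set ℝ := {t : ℝ | 0 ≤ t ∧ (t : EReal) < a}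

/-- The filter of `t → a_f⁻`. -/
def afFilter (a : EReal) : Filter ℝ :=
  if a = ⊤ then Filter.atTop else nhdsWithin a.toReal (Set.Iio a.toReal)

/-- Hypothesis (H) on the nonlinearity `f : [0, a_f) → ℝ₊`. -/
structure HypH (a : EReal) (f : ℝ → ℝ) : Prop where
  a_pos : 0 < a
  smooth : ContDiffOn ℝ (⊤ : ℕ∞) f (domf a)
  mono : StrictMonoOn f (domf a)
  convex : ConvexOn ℝ (domf a) f
  f0_pos : 0 < f 0
  pos : ∀ t ∈ domf a, 0 < f t
  blowup : Filter.Tendsto f (afFilter a) Filter.atTop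
  superlinear : a = ⊤ → Filter.Tendsto (fun t => f t / t) Filter.atTop Filter.atTop

/-- `τ₋ = liminf_{t → a_f} f f'' / (f')²`. -/
def tauMinus (a : EReal) (f : ℝ → ℝ) : ℝ :=
  Filter.liminf (fun t => f t * deriv (deriv f) t / (deriv f t) ^ 2) (afFilter a)

/-- `τ₊ = limsup_{t → a_f} f f'' / (f')²`. -/
def tauPlus (a : EReal) (f : ℝ → ℝ) : ℝ :=
  Filter.limsup (fun t => f t * deriv (deriv f) t / (deriv f t) ^ 2) (afFilter a)

/-- `u` is a (smooth, `[0,a_f)`-valued) solution of `Δ²u = λ f(u)` in `Ω`,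
`u = Δu = 0` on `∂Ω`. -/
def Solves {n : ℕ} (Ω : Set (EuclideanSpace ℝ (Fin n))) (a : EReal) (lam : ℝ)
    (f : ℝ → ℝ) (u : EuclideanSpace ℝ (Fin n) → ℝ) : Prop :=
  ContDiff ℝ (⊤ : ℕ∞) u ∧ (∀ x ∈ Ω, 0 ≤ u x ∧ (u x : EReal) < a) ∧
  (∀ x ∈ Ω, lap (lap u) x = lam * f (u x)) ∧
  (∀ x ∈ frontier Ω, u x = 0) ∧ (∀ x ∈ frontier Ω, lap u x = 0)

/-- `u` is a semistable solution: the second variation is nonnegative over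
test functions in `H² ∩ H¹₀` (modelled by smooth functions vanishing on `∂Ω`). -/
def Semistable {n : ℕ} (Ω : Set (EuclideanSpace ℝ (Fin n))) (lam : ℝ)
    (f : ℝ → ℝ) (u : EuclideanSpace ℝ (Fin n) → ℝ) : Prop :=
  ∀ φ : EuclideanSpace ℝ (Fin n) → ℝ, ContDiff ℝ (⊤ : ℕ∞) φ → (∀ x ∈ frontier Ω, φ x = 0) →
    0 ≤ ∫ x in Ω, ((lap φ x) ^ 2 - lam * deriv f (u x) * (φ x) ^ 2)

/-- `u` satisfies the stability inequality
`√λ ∫ √(f'(u)) φ² ≤ ∫ |∇φ|²` for all `φ ∈ H¹₀(Ω)`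
(modelled by smooth compactly supported test functions). -/
def StabIneq {n : ℕ} (Ω : Set (EuclideanSpace ℝ (Fin n))) (lam : ℝ)
    (f : ℝ → ℝ) (u : EuclideanSpace ℝ (Fin n) → ℝ) : Prop :=
  ∀ φ : EuclideanSpace ℝ (Fin n) → ℝ, ContDiff ℝ (⊤ : ℕ∞) φ → HasCompactSupport φ →
    tsupport φ ⊆ Ω →
    Real.sqrt lam * ∫ x in Ω, Real.sqrt (deriv f (u x)) * (φ x) ^ 2 ≤
      ∫ x in Ω, ‖gradient φ x‖ ^ 2

/-- The quartic polynomial `P_f(α, τ₋, τ₊)`. -/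
def Pf (τm τp α : ℝ) : ℝ :=
  (2 - τm) ^ 2 * α ^ 4 - 8 * (2 - τp) * α ^ 2 + 4 * (4 - 3 * τp) * α - 4 * (1 - τp)

/-- `F(t) = ∫₀ᵗ f(s) ds`. -/
def Fint (f : ℝ → ℝ) (t : ℝ) : ℝ := ∫ s in (0:ℝ)..t, f s

/-- `f̃(t) = f(t) - f(0)`. -/
def ftil (f : ℝ → ℝ) (t : ℝ) : ℝ := f t - f 0

/-- `Θ(t) = ∫₀ᵗ θ'(s)² ds`. -/
def Theta (θ : ℝ → ℝ) (t : ℝ) : ℝ := ∫ s in (0:ℝ)..t, (deriv θ s) ^ 2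


lemma Pf_neg_of_lt {τm τp αs β : ℝ} (h0 : 0 < τp) (h2 : τp < 2)
    (hroot : Pf τm τp αs = 0) (hβ : 1 ≤ β) (hlt : β < αs) : Pf τm τp β < 0 := by
  have hβ0 : 0 < β := by linarith
  have ha0 : 0 < αs := by linarith
  have key : ∀ x : ℝ, Pf τm τp x = (2 - τm)^2 * x^4 - 4 * ((2*x-1) * (2*x-1-(x-1)*τp)) := by
    intro x; unfold Pf; ring
  rw [key] at hroot ⊢
  have h1 : (2*αs-1) * β^2 < (2*β-1) * αs^2 := by
    nlinarith [mul_pos (sub_pos.2 hlt) hβ0, mul_nonneg (sub_nonneg.2 hβ) ha0.le,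
      mul_pos (sub_pos.2 hlt) (show 0 < 2*αs*β - αs - β by nlinarith)]
  have h3 : (2*αs-1-(αs-1)*τp) * β^2 < (2*β-1-(β-1)*τp) * αs^2 := by
    have e : (2*β-1-(β-1)*τp) * αs^2 - (2*αs-1-(αs-1)*τp) * β^2
      = (αs - β) * ((2-τp) * αs * β - (1 - τp) * (αs + β)) := by ring
    have : 0 < (2-τp) * αs * β - (1 - τp) * (αs + β) := by
      have e2 : (2-τp) * αs * β - (1 - τp) * (αs + β) =
        (2 - τp) * ((αs-1) * (β-1)) + (αs + β - 1) + (τp - 1) := by ring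
      rw [e2]
      have : 0 ≤ (2 - τp) * ((αs-1) * (β-1)) := by
        apply mul_nonneg (by linarith) (mul_nonneg (by linarith) (by linarith))
      linarith
    nlinarith [mul_pos (sub_pos.2 hlt) this]
  have p1 : 0 < (2*αs-1) * β^2 := by apply mul_pos (by linarith) (by positivity)
  have p2 : 0 < 2*αs-1-(αs-1)*τp := by nlinarith
  have p3 : 0 < (2*αs-1-(αs-1)*τp) * β^2 := mul_pos p2 (by positivity)
  have h4 := mul_lt_mul'' h1 h3 p1.le p3.le
  have h5 : αs^4 * ((2 - τm)^2 * β^4) < αs^4 * (4 * ((2*β-1) * (2*β-1-(β-1)*τp))) := by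
    have : (2 - τm)^2 * αs^4 = 4 * ((2*αs-1) * (2*αs-1-(αs-1)*τp)) := by linarith
    calc αs^4 * ((2 - τm)^2 * β^4) = ((2 - τm)^2 * αs^4) * β^4 := by ring
      _ = 4 * ((2*αs-1) * β^2 * ((2*αs-1-(αs-1)*τp) * β^2)) := by rw [this]; ring
      _ < 4 * ((2*β-1) * αs^2 * ((2*β-1-(β-1)*τp) * αs^2)) := by linarith
      _ = _ := by ring
  have := lt_of_mul_lt_mul_left h5 (by positivity)
  linarith

lemma Pf_cont (τm τp : ℝ) : Continuous (Pf τm τp) := by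
  unfold Pf; fun_prop

lemma one_lt_root {τm τp αs : ℝ} (hm : 0 < τm) (hmp : τm ≤ τp) (h2 : τp < 2)
    (hmax : ∀ β : ℝ, Pf τm τp β = 0 → β ≤ αs) : 1 < αs := by
  set k := (2 - τm)^2 with hk
  have hk0 : 0 < k := by rw [hk]; have : 0 < 2 - τm := by linarith
                         positivity
  have h1 : Pf τm τp 1 < 0 := by unfold Pf; nlinarith
  set x := 1 + 28 / k with hx
  have hx1 : 1 < x := by rw [hx]; have : 0 < 28 / k := by positivity
                         linarith
  have hx2 : 0 < Pf τm τp x := by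
    have e1 : 28 < k * x := by
      rw [hx, mul_add, mul_div_cancel₀ _ hk0.ne']; linarith
    have e2 : 28 < k * x^2 := by nlinarith
    have e3 : 28 * x^2 < k * x^4 := by
      have := mul_lt_mul_of_pos_right e2 (show 0 < x^2 by positivity)
      nlinarith
    have e4 : x ≤ x^2 := by nlinarith
    unfold Pf
    rw [← hk]
    nlinarith [mul_nonneg (show (0:ℝ) ≤ τp by linarith) (sq_nonneg x)]
  obtain ⟨y, hy, hy0⟩ := intermediate_value_Ioo hx1.le (Pf_cont τm τp).continuousOn ⟨h1, hx2⟩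
  exact lt_of_lt_of_le hy.1 (hmax y hy0)

lemma choose_params (n : ℕ) {τm τp αs : ℝ} (hm : 0 < τm) (hmp : τm ≤ τp) (h2 : τp < 2)
    (hroot : Pf τm τp αs = 0) (hmax : ∀ β : ℝ, Pf τm τp β = 0 → β ≤ αs)
    (hn : (n : ℝ) < (4 * αs * (2 - τp) + 2 * τp) / τp * max 1 τp) :
    ∃ α a τ : ℝ, 1 < α ∧ 0 < a ∧ a < τm ∧ τp < τ ∧ τ < 2 ∧ Pf a τ α < 0 ∧
      (n : ℝ) * min 1 τ < 4 * (α * (2 - τ) + τ / 2) := by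
  have h1 := one_lt_root hm hmp h2 hmax
  have hp : 0 < τp := by linarith
  have hn' : (n : ℝ) * min 1 τp < 4 * (αs * (2 - τp) + τp / 2) := by
    have hmm : max 1 τp * min 1 τp = τp := by rw [max_mul_min]; simp
    have hmin : 0 < min 1 τp := lt_min one_pos hp
    have := mul_lt_mul_of_pos_right hn hmin
    rw [mul_assoc, hmm, div_mul_cancel₀ _ hp.ne'] at this
    linarith
  have ev1 : ∀ᶠ α in 𝓝[<] αs, (n : ℝ) * min 1 τp < 4 * (α * (2 - τp) + τp / 2) := by
    apply eventually_nhdsWithin_of_eventually_nhds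
    have : ContinuousAt (fun α : ℝ => 4 * (α * (2 - τp) + τp / 2)) αs := by fun_prop
    exact this.eventually_const_lt hn'
  have ev2 : ∀ᶠ α in 𝓝[<] αs, α ∈ Ioo 1 αs := Ioo_mem_nhdsLT h1
  obtain ⟨α, hα1, hα2⟩ := (ev1.and ev2).exists
  have hneg := Pf_neg_of_lt (τm := τm) hp h2 hroot hα2.1.le hα2.2
  have ev3 : ∀ᶠ e in 𝓝[>] (0:ℝ), Pf (τm - e) (τp + e) α < 0 := by
    apply eventually_nhdsWithin_of_eventually_nhds
    have : ContinuousAt (fun e : ℝ => Pf (τm - e) (τp + e) α) 0 := by unfold Pf; fun_prop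
    exact this.eventually_lt_const (by simpa using hneg)
  have ev4 : ∀ᶠ e in 𝓝[>] (0:ℝ), (n : ℝ) * min 1 (τp+e) < 4 * (α * (2 - (τp+e)) + (τp+e) / 2) := by
    apply eventually_nhdsWithin_of_eventually_nhds
    have : ContinuousAt (fun e : ℝ => 4 * (α * (2 - (τp+e)) + (τp+e) / 2) - (n : ℝ) * min 1 (τp+e)) 0 := by
      fun_prop
    have := this.eventually_const_lt (u := 0) (by simpa using hα1)
    filter_upwards [this] with e he using by linarith
  have ev5 : ∀ᶠ e in 𝓝[>] (0:ℝ), e ∈ Ioo 0 (min τm (2-τp)) := Ioo_mem_nhdsGT (lt_min hm (by linarith))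
  obtain ⟨e, h3, h4, h5⟩ := (ev3.and (ev4.and ev5)).exists
  have := lt_min_iff.1 h5.2
  exact ⟨α, τm - e, τp + e, hα2.1, by linarith, by linarith [h5.1], by linarith [h5.1], by linarith,
    h3, h4⟩


lemma domf_top : domf ⊤ = Ici (0:ℝ) := by
  ext t; simp [domf, EReal.coe_lt_top]

section RealPart
variable {f : ℝ → ℝ}

lemma hf_cd (hf : HypH ⊤ f) {t : ℝ} (ht : 0 < t) : ContDiffAt ℝ (⊤ : ℕ∞) f t := by
  have := hf.smooth
  rw [domf_top] at this
  exact this.contDiffAt (Ici_mem_nhds ht)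

lemma hf_cdo (hf : HypH ⊤ f) : ContDiffOn ℝ (⊤ : ℕ∞) f (Ioi 0) := by
  have := hf.smooth
  rw [domf_top] at this
  exact this.mono Ioi_subset_Ici_self

lemma hf_cdo' (hf : HypH ⊤ f) : ContDiffOn ℝ (⊤ : ℕ∞) (deriv f) (Ioi 0) :=
  (hf_cdo hf).deriv_of_isOpen isOpen_Ioi (by simp)

lemma hf_d1 (hf : HypH ⊤ f) {t : ℝ} (ht : 0 < t) : HasDerivAt f (deriv f t) t :=
  ((hf_cd hf ht).differentiableAt (by simp)).hasDerivAt

lemma hf_d2 (hf : HypH ⊤ f) {t : ℝ} (ht : 0 < t) :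
    HasDerivAt (deriv f) (deriv (deriv f) t) t :=
  (((hf_cdo' hf).contDiffAt (Ioi_mem_nhds ht)).differentiableAt (by simp)).hasDerivAt

lemma hf_pos (hf : HypH ⊤ f) {t : ℝ} (ht : 0 ≤ t) : 0 < f t :=
  hf.pos t (by rw [domf_top]; exact ht)

lemma hf_mono (hf : HypH ⊤ f) {s t : ℝ} (hs : 0 ≤ s) (hst : s ≤ t) : f s ≤ f t :=
  hf.mono.monotoneOn (by rw [domf_top]; exact hs) (by rw [domf_top]; exact hs.trans hst) hst

lemma hf_slope (hf : HypH ⊤ f) {s t : ℝ} (hs : 0 ≤ s) (hst : s < t) :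
    f t - f s ≤ deriv f t * (t - s) := by
  have hc := hf.convex
  rw [domf_top] at hc
  have ht : 0 < t := lt_of_le_of_lt hs hst
  have := hc.slope_le_of_hasDerivAt (x := s) (y := t) hs ht.le hst (hf_d1 hf ht)
  rw [slope_def_field, div_le_iff₀ (by linarith)] at this
  exact this

lemma hf_dpos (hf : HypH ⊤ f) {t : ℝ} (ht : 0 < t) : 0 < deriv f t := by
  have h1 := hf_slope hf le_rfl ht
  have h2 : f 0 < f t := hf.mono (by rw [domf_top]; exact self_mem_Ici)
    (by rw [domf_top]; exact ht.le) ht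
  by_contra h
  push Not at h
  nlinarith

lemma hf_dmono (hf : HypH ⊤ f) {s t : ℝ} (hs : 0 < s) (hst : s ≤ t) : deriv f s ≤ deriv f t := by
  have hc := hf.convex
  rw [domf_top] at hc
  have := (hc.subset Ioi_subset_Ici_self (convex_Ioi 0)).monotoneOn_deriv
    (fun x hx => (hf_d1 hf hx).differentiableAt)
  exact this hs (hs.trans_le hst) hst

lemma tau_ev {f : ℝ → ℝ} (hτm : 0 < tauMinus ⊤ f) (hττ : tauMinus ⊤ f ≤ tauPlus ⊤ f)
    {a τ : ℝ} (ha : a < tauMinus ⊤ f) (hτ : tauPlus ⊤ f < τ) :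
    ∀ᶠ t in atTop, a ≤ f t * deriv (deriv f) t / (deriv f t) ^ 2 ∧
      f t * deriv (deriv f) t / (deriv f t) ^ 2 ≤ τ := by
  set g := fun t => f t * deriv (deriv f) t / (deriv f t) ^ 2
  have e : afFilter ⊤ = atTop := by simp [afFilter]
  unfold tauMinus at hτm ha hττ
  unfold tauPlus at hττ hτ
  rw [e] at hτm hττ ha hτ
  change 0 < liminf g atTop at hτm
  change liminf g atTop ≤ limsup g atTop at hττ
  change limsup g atTop < τ at hτ
  change a < liminf g atTop at ha
  have hb : IsBoundedUnder (· ≤ ·) atTop g := by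
    by_contra hb
    have : limsup g atTop = 0 := by
      rw [limsup_eq, ← Real.sInf_empty]
      congr 1
      ext b
      simp only [mem_setOf_eq, mem_empty_iff_false, iff_false]
      intro h
      exact hb ⟨b, h⟩
    linarith
  have hb2 : IsBoundedUnder (· ≥ ·) atTop g := by
    by_contra hb
    have : liminf g atTop = 0 := by
      rw [liminf_eq, ← Real.sSup_empty]
      congr 1
      ext b
      simp only [mem_setOf_eq, mem_empty_iff_false, iff_false]
      intro h
      exact hb ⟨b, h⟩
    linarith
  filter_upwards [eventually_lt_of_limsup_lt hτ hb, eventually_lt_of_lt_liminf ha hb2] with t h1 h2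
  exact ⟨h2.le, h1.le⟩

lemma cut_theta (g k k' : ℝ → ℝ) {T0 A : ℝ} (hT0 : 0 < T0) (hg : ContDiffOn ℝ (⊤ : ℕ∞) g (Ioi 0))
    (hk : ∀ t > T0, HasDerivAt k (k' t) t) (hkn : ∀ t > T0, 0 ≤ k t) (hA : 0 ≤ A)
    (hb : ∀ t > T0 + 1, (deriv g t)^2 ≤ A * k' t) :
    ∃ θ Θ : ℝ → ℝ, ∃ C : ℝ, 0 ≤ C ∧ ContDiff ℝ (⊤ : ℕ∞) θ ∧ ContDiff ℝ (⊤ : ℕ∞) Θ ∧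
      (∀ t ≤ T0 / 2, θ t = 0 ∧ Θ t = 0) ∧
      (∀ t, HasDerivAt Θ ((deriv θ t)^2) t) ∧ (∀ t ≥ T0 + 1, θ t = g t) ∧
      (∀ t ≤ T0 + 1, Θ t ≤ C) ∧ ∀ t ≥ T0 + 1, Θ t ≤ A * k t + C := by
  set θ : ℝ → ℝ := fun t => smoothTransition (t - T0) * g t with hθ
  have hθ0 : ∀ t ≤ T0, θ t = 0 := fun t ht => by
    simp only [hθ]; rw [smoothTransition.zero_of_nonpos (by linarith), zero_mul]
  have hθ1 : ∀ t ≥ T0 + 1, θ t = g t := fun t ht => by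
    simp only [hθ]; rw [smoothTransition.one_of_one_le (by linarith), one_mul]
  have hθc : ContDiff ℝ (⊤ : ℕ∞) θ := by
    rw [contDiff_iff_contDiffAt]
    intro t
    rcases lt_or_ge t T0 with h | h
    · apply (contDiffAt_const (c := (0:ℝ))).congr_of_eventuallyEq
      filter_upwards [Iio_mem_nhds h] with s hs using hθ0 s (le_of_lt hs)
    · apply ContDiffAt.mul
      · exact (smoothTransition.contDiff.comp (contDiff_id.sub contDiff_const)).contDiffAt
      · exact hg.contDiffAt (Ioi_mem_nhds (by linarith))
  have hd : Continuous (fun t => (deriv θ t)^2) := (hθc.continuous_deriv (by simp)).pow 2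
  have hΘ : ∀ t, HasDerivAt (Theta θ) ((deriv θ t)^2) t := fun t =>
    (hd.integral_hasStrictDerivAt 0 t).hasDerivAt
  have hΘc : ContDiff ℝ (⊤ : ℕ∞) (Theta θ) := by
    rw [contDiff_infty_iff_deriv]
    refine ⟨fun t => (hΘ t).differentiableAt, ?_⟩
    have : deriv (Theta θ) = fun t => (deriv θ t)^2 := funext fun t => (hΘ t).deriv
    rw [this]
    exact ((contDiff_infty_iff_deriv.1 hθc).2).pow 2
  have hmono : Monotone (Theta θ) := monotone_of_hasDerivAt_nonneg hΘ (fun t => sq_nonneg _)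
  have h0 : Theta θ 0 = 0 := by simp [Theta]
  refine ⟨θ, Theta θ, Theta θ (T0 + 1), ?_, hθc, hΘc, ?_, hΘ, hθ1, fun t ht => hmono ht, ?_⟩
  · rw [← h0]; exact hmono (by linarith)
  · intro t ht
    refine ⟨hθ0 t (by linarith), ?_⟩
    unfold Theta
    apply intervalIntegral.integral_zero_ae
    refine Eventually.of_forall fun s hs => ?_
    have hs' : s < T0 := by
      have := hs.2
      rcases le_total 0 t with h | h
      · rw [max_eq_right h] at this; linarith
      · rw [max_eq_left h] at this; linarith
    have : θ =ᶠ[𝓝 s] fun _ => 0 := by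
      filter_upwards [Iio_mem_nhds hs'] with r hr using hθ0 r (le_of_lt hr)
    rw [this.deriv_eq]; simp
  · intro t ht
    have hanti : AntitoneOn (fun t => Theta θ t - A * k t) (Ici (T0+1)) := by
      apply antitoneOn_of_hasDerivWithinAt_nonpos (convex_Ici _)
        (f' := fun t => (deriv θ t)^2 - A * k' t)
      · intro s hs
        have hs' : T0 < s := lt_of_lt_of_le (by linarith) hs
        exact ((hΘ s).continuousAt.sub ((hk s hs').continuousAt.const_mul A)).continuousWithinAt
      · intro s hs
        rw [interior_Ici] at hs
        have hs' : T0 < s := lt_trans (by linarith) hs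
        exact ((hΘ s).sub ((hk s hs').const_mul A)).hasDerivWithinAt
      · intro s hs
        rw [interior_Ici] at hs
        have : θ =ᶠ[𝓝 s] g := by
          filter_upwards [Ioi_mem_nhds hs] with r hr using hθ1 r (le_of_lt hr)
        rw [this.deriv_eq]
        linarith [hb s hs]
    have := hanti (self_mem_Ici) ht ht
    simp only at this
    have := mul_nonneg hA (hkn (T0+1) (by linarith))
    linarith

lemma young_sys {q A B : ℝ} (hq : 1 < q) (hA : 0 < A) (hB : 0 < B) (hAB : A * B < 1) :
    ∃ ρ ε : ℝ, 0 < ρ ∧ 0 < ε ∧ ε < 1 ∧ ∀ z s : ℝ, 0 ≤ z → 0 ≤ s →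
      ρ * (A * z^(q-1) * s) + B * s^(q-1) * z ≤ (1 - 2*ε) * (ρ * z^q + s^q) := by
  set r := √(B/A) with hr
  set m := √(A*B) with hm
  have hr0 : 0 < r := by positivity
  have hm0 : 0 < m := by positivity
  have hm1 : m < 1 := by rw [hm, Real.sqrt_lt' one_pos]; simpa using hAB
  have hr2 : r^2 = B/A := Real.sq_sqrt (by positivity)
  have hm2 : m^2 = A*B := Real.sq_sqrt (by positivity)
  have e1 : A * r = m := by
    have : (A*r)^2 = m^2 := by rw [mul_pow, hr2, hm2]; field_simp
    exact (pow_left_inj₀ (by positivity) hm0.le two_ne_zero).1 this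
  have e2 : B = m * r := by
    have : B^2 = (m*r)^2 := by rw [mul_pow, hr2, hm2]; field_simp
    exact (pow_left_inj₀ (by positivity) (by positivity) two_ne_zero).1 this
  have sp : ∀ y : ℝ, 0 ≤ y → y^q = y^(q-1) * y := by
    intro y hy
    rcases hy.eq_or_lt with h | h
    · rw [← h, Real.zero_rpow (by linarith)]; simp
    · rw [← Real.rpow_add_one h.ne']; ring_nf
  refine ⟨r^q, (1-m)/2, by positivity, by linarith, by linarith, ?_⟩
  intro z s hz hs
  set y := r * z with hy
  have hy0 : 0 ≤ y := by positivity
  have f1 : r^q * z^q = y^q := by rw [hy, Real.mul_rpow hr0.le hz]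
  have f2 : r^q * (A * z^(q-1) * s) = m * (y^(q-1) * s) := by
    rw [hy, Real.mul_rpow hr0.le hz, sp r hr0.le, ← e1]; ring
  have f3 : B * s^(q-1) * z = m * (s^(q-1) * y) := by rw [e2, hy]; ring
  rw [f1, f2, f3, sp y hy0, sp s hs]
  have : 0 ≤ (y^(q-1) - s^(q-1)) * (y - s) := by
    rcases le_total y s with h | h
    · exact mul_nonneg_of_nonpos_of_nonpos
        (sub_nonpos.2 (Real.rpow_le_rpow hy0 h (by linarith))) (by linarith)
    · exact mul_nonneg (sub_nonneg.2 (Real.rpow_le_rpow hs h (by linarith))) (by linarith)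
  nlinarith

lemma pow_absorb {b q δ : ℝ} (hb : 0 < b) (hbq : b < q) (hδ : 0 < δ) :
    ∃ C : ℝ, 0 ≤ C ∧ ∀ s : ℝ, 0 ≤ s → s^b ≤ δ * s^q + C := by
  refine ⟨((1/δ)^(1/(q-b)))^b, by positivity, ?_⟩
  intro s hs
  have hqb : 0 < q - b := by linarith
  rcases le_total s ((1/δ)^(1/(q-b))) with h | h
  · have := Real.rpow_le_rpow hs h hb.le
    have : 0 ≤ δ * s^q := by positivity
    linarith
  · have hs0 : 0 < s := lt_of_lt_of_le (by positivity) h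
    have h1 := Real.rpow_le_rpow (by positivity) h hqb.le
    rw [← Real.rpow_mul (by positivity), one_div_mul_cancel hqb.ne', Real.rpow_one] at h1
    have h2 : s^q = s^(q-b) * s^b := by rw [← Real.rpow_add hs0]; ring_nf
    have h3 : 1 ≤ δ * s^(q-b) := by
      rw [div_le_iff₀ hδ] at h1; linarith
    have h4 : 0 ≤ ((1/δ)^(1/(q-b)))^b := by positivity
    have h5 : 0 < s^b := by positivity
    rw [h2]
    nlinarith

end RealPart


section RealPart2
variable {f : ℝ → ℝ}

lemma ff_le (hf : HypH ⊤ f) {t τ : ℝ} (ht : 0 < t)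
    (h : f t * deriv (deriv f) t / (deriv f t) ^ 2 ≤ τ) :
    f t * deriv (deriv f) t ≤ τ * (deriv f t)^2 := by
  have := hf_dpos hf ht
  rwa [div_le_iff₀ (by positivity)] at h

lemma real_growth (hf : HypH ⊤ f) {τ T : ℝ} (hτ0 : 0 < τ) (hT : 0 < T)
    (hev : ∀ t ≥ T, f t * deriv (deriv f) t / (deriv f t) ^ 2 ≤ τ) :
    ∃ c : ℝ, 0 < c ∧ ∀ t > 0, deriv f t ≤ c * f t ^ τ := by
  have f0 := hf_pos hf le_rfl
  have fT := hf_pos hf hT.le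
  have dT := hf_dpos hf hT
  have base : ∀ t : ℝ, 0 ≤ t → 1 ≤ f 0 ^ (-τ) * f t ^ τ := by
    intro t ht
    have h1 : f 0 ^ τ ≤ f t ^ τ := Real.rpow_le_rpow f0.le (hf_mono hf le_rfl ht) hτ0.le
    rw [Real.rpow_neg f0.le, inv_mul_eq_div, le_div_iff₀ (by positivity)]
    linarith
  refine ⟨deriv f T * f 0 ^ (-τ), by positivity, ?_⟩
  intro t ht
  rcases le_total t T with h | h
  · have h1 := hf_dmono hf ht h
    have h2 := base t ht.le
    calc deriv f t ≤ deriv f T * 1 := by linarith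
      _ ≤ deriv f T * (f 0 ^ (-τ) * f t ^ τ) := by gcongr
      _ = _ := by ring
  · have hanti : AntitoneOn (fun t => deriv f t * f t ^ (-τ)) (Ici T) := by
      have hd : ∀ s ≥ T, HasDerivAt (fun t => deriv f t * f t ^ (-τ))
          (deriv (deriv f) s * f s ^ (-τ) + deriv f s * (deriv f s * (-τ) * f s ^ (-τ - 1))) s := by
        intro s hs
        have hs0 : 0 < s := lt_of_lt_of_le hT hs
        exact (hf_d2 hf hs0).mul ((hf_d1 hf hs0).rpow_const (Or.inl (hf_pos hf hs0.le).ne'))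
      apply antitoneOn_of_hasDerivWithinAt_nonpos (convex_Ici _)
        (fun s hs => (hd s hs).continuousAt.continuousWithinAt)
        (fun s hs => (hd s (interior_subset hs)).hasDerivWithinAt)
      intro s hs
      have hs := interior_subset hs
      have hs0 : 0 < s := lt_of_lt_of_le hT hs
      have fs := hf_pos hf hs0.le
      have h1 := ff_le hf hs0 (hev s hs)
      have h2 : f s ^ (-τ) = f s ^ (-τ - 1) * f s := by
        rw [← Real.rpow_add_one fs.ne']; ring_nf
      rw [h2]
      have h3 : 0 < f s ^ (-τ - 1) := by positivity
      have : deriv (deriv f) s * (f s ^ (-τ - 1) * f s) + deriv f s * (deriv f s * (-τ) * f s ^ (-τ - 1))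
        = f s ^ (-τ - 1) * (f s * deriv (deriv f) s - τ * deriv f s^2) := by ring
      rw [this]
      exact mul_nonpos_of_nonneg_of_nonpos h3.le (by linarith)
    have h1 := hanti self_mem_Ici h h
    simp only at h1
    have ft := hf_pos hf ht.le
    have h2 : f T ^ (-τ) ≤ f 0 ^ (-τ) :=
      Real.rpow_le_rpow_of_nonpos f0 (hf_mono hf le_rfl hT.le) (by linarith)
    have h3 : f t ^ (-τ) * f t ^ τ = 1 := by
      rw [← Real.rpow_add ft]; simp
    calc deriv f t = (deriv f t * f t ^ (-τ)) * f t ^ τ := by rw [mul_assoc, h3, mul_one]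
      _ ≤ (deriv f T * f T ^ (-τ)) * f t ^ τ := by gcongr
      _ ≤ _ := by gcongr

lemma real_lin (hf : HypH ⊤ f) : ∃ c : ℝ, 0 < c ∧ ∀ t ≥ 0, t ≤ c * f t := by
  have f0 := hf_pos hf le_rfl
  obtain ⟨T, hT⟩ := eventually_atTop.1 ((hf.superlinear rfl).eventually_ge_atTop 1)
  refine ⟨1 + |T| / f 0 + 1 / f 0, by positivity, ?_⟩
  intro t ht
  have ft := hf_pos hf ht
  have hm := hf_mono hf le_rfl ht
  rcases le_total (|T| + 1) t with h | h
  · have h1 := hT t (by linarith [le_abs_self T])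
    have ht0 : 0 < t := by linarith [abs_nonneg T]
    rw [le_div_iff₀ ht0] at h1
    have : 0 ≤ (|T| / f 0 + 1 / f 0) * f t := by positivity
    nlinarith
  · have : |T| + 1 = (|T| / f 0 + 1 / f 0) * f 0 := by field_simp
    have h2 : (|T| / f 0 + 1 / f 0) * f 0 ≤ (|T| / f 0 + 1 / f 0) * f t := by gcongr
    nlinarith

lemma real_sigma (hf : HypH ⊤ f) {τ c : ℝ} (hτ0 : 0 < τ) (hc : 0 < c)
    (h : ∀ t > 0, deriv f t ≤ c * f t ^ τ) :
    ∃ C : ℝ, 0 < C ∧ ∀ t > 0, f t ≤ C * (1 + t) * f t ^ (min 1 τ) := by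
  have f0 := hf_pos hf le_rfl
  rcases le_total 1 τ with h1 | h1
  · refine ⟨1, one_pos, fun t ht => ?_⟩
    have ft := hf_pos hf ht.le
    rw [min_eq_left h1, Real.rpow_one]
    nlinarith
  · refine ⟨c + f 0 ^ (1 - τ), by positivity, fun t ht => ?_⟩
    have ft := hf_pos hf ht.le
    rw [min_eq_right h1]
    have h2 := hf_slope hf le_rfl ht
    have h3 : f 0 = f 0 ^ (1 - τ) * f 0 ^ τ := by rw [← Real.rpow_add f0]; simp
    have h4 : f 0 ^ τ ≤ f t ^ τ := Real.rpow_le_rpow f0.le (hf_mono hf le_rfl ht.le) hτ0.le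
    have h5 : f 0 ≤ f 0 ^ (1 - τ) * f t ^ τ := by
      calc f 0 = f 0 ^ (1 - τ) * f 0 ^ τ := h3
        _ ≤ _ := by gcongr
    have h6 : deriv f t * (t - 0) ≤ c * f t ^ τ * t := by
      rw [sub_zero]; exact mul_le_mul_of_nonneg_right (h t ht) ht.le
    have h7 : 0 ≤ f 0 ^ (1 - τ) * t * f t ^ τ := by positivity
    have h8 : 0 ≤ c * f t ^ τ := by positivity
    nlinarith

set_option maxHeartbeats 4000000 in
lemma real_key (hf : HypH ⊤ f) {α a τ p T0 : ℝ} (hα : 1 < α) (ha : 0 < a) (haτ : a < τ) (hτ2 : τ < 2)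
    (hP : Pf a τ α < 0) (hp : p = α * (2 - τ) + τ / 2) (hT0 : 0 < T0)
    (hev : ∀ t ≥ T0, a ≤ f t * deriv (deriv f) t / (deriv f t) ^ 2 ∧
      f t * deriv (deriv f) t / (deriv f t) ^ 2 ≤ τ) {c : ℝ} (hc : 0 < c) :
    ∃ θ Θ ψ Ψ : ℝ → ℝ, ∃ ρ ε κ C T : ℝ, 0 < T ∧ 0 < ρ ∧ 0 < ε ∧ ε < 1 ∧ 0 < κ ∧
      ContDiff ℝ (⊤ : ℕ∞) θ ∧ ContDiff ℝ (⊤ : ℕ∞) Θ ∧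
      ContDiff ℝ (⊤ : ℕ∞) ψ ∧ ContDiff ℝ (⊤ : ℕ∞) Ψ ∧
      (∀ t ≤ T, θ t = 0 ∧ Θ t = 0) ∧ (∀ t ≤ T, ψ t = 0 ∧ Ψ t = 0) ∧
      (∀ t, HasDerivAt Θ ((deriv θ t)^2) t) ∧ (∀ t, HasDerivAt Ψ ((deriv ψ t)^2) t) ∧
      ∀ t > 0, ∀ s > 0, ρ * (Θ t * s) + Ψ s * f t ≤
        ρ * (√(deriv f t) * θ t ^ 2) + (1 - ε) * (√(deriv f t) * ψ s ^ 2) + ε * c * ψ s ^ 2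
          - κ * f t ^ p - κ * s + C := by
  have f0 := hf_pos hf le_rfl
  have hτ0 : 0 < τ := ha.trans haτ
  obtain ⟨cg, hcg, hgr⟩ := real_growth hf hτ0 hT0 (fun t ht => (hev t ht).2)
  have hp1 : 1 < p := by
    rw [hp]; nlinarith
  set q := 2 * α with hq
  set w : ℝ → ℝ := fun t => √(deriv f t) with hw
  set z : ℝ → ℝ := fun t => f t / w t with hz
  have wpos : ∀ t > 0, 0 < w t := fun t ht => Real.sqrt_pos.2 (hf_dpos hf ht)
  have zpos : ∀ t > 0, 0 < z t := fun t ht => div_pos (hf_pos hf (le_of_lt ht)) (wpos t ht)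
  have wsq : ∀ t > 0, w t ^ 2 = deriv f t := fun t ht => Real.sq_sqrt (hf_dpos hf ht).le
  have fwz : ∀ t > 0, f t = w t * z t := fun t ht => by
    simp only [hz]; rw [mul_div_cancel₀ _ (wpos t ht).ne']
  set R : ℝ → ℝ := fun t => f t * deriv (deriv f) t / (deriv f t) ^ 2 with hR
  have hRw : ∀ t > 0, f t * deriv (deriv f) t = R t * w t ^ 4 := by
    intro t ht
    have := (hf_dpos hf ht).ne'
    simp only [hR]
    rw [show w t ^ 4 = (w t ^ 2)^2 by ring, wsq t ht]
    field_simp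
  have hwd : ∀ t > 0, HasDerivAt w (deriv (deriv f) t / (2 * w t)) t := fun t ht =>
    (hf_d2 hf ht).sqrt (hf_dpos hf ht).ne'
  have hzd : ∀ t > 0, HasDerivAt z (w t * (1 - R t / 2)) t := by
    intro t ht
    have h1 := (hf_d1 hf ht).div (hwd t ht) (wpos t ht).ne'
    refine HasDerivAt.congr_deriv (f := z) h1 ?_
    symm
    have hw0 := (wpos t ht).ne'
    rw [← wsq t ht]
    have := hRw t ht
    rw [eq_div_iff (by positivity)]
    have h2 : f t * (deriv (deriv f) t / (2 * w t)) = (f t * deriv (deriv f) t) / (2 * w t) := by ring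
    rw [h2, this]
    field_simp
  -- constants
  set D := 2 * α - 1 - (α - 1) * τ with hD
  have hDpos : 0 < D := by rw [hD]; nlinarith
  set A := α^2 * (1 - a/2)^2 / D with hA
  set B := α^2 / (2*α - 1) with hB
  have h1a : 0 < 1 - a/2 := by linarith
  have h2α : 0 < 2*α - 1 := by linarith
  have hApos : 0 < A := by positivity
  have hBpos : 0 < B := by positivity
  have hAB : A * B < 1 := by
    rw [hA, hB, div_mul_div_comm, div_lt_one (by positivity)]
    unfold Pf at hP
    rw [hD]
    nlinarith
  obtain ⟨ρ, ε, hρ, hε, hε1, hyoung⟩ := young_sys (q := q) (by linarith) hApos hBpos hAB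
  -- theta
  have hgc : ContDiffOn ℝ (⊤ : ℕ∞) (fun t => z t ^ α) (Ioi 0) := by
    have hwc : ContDiffOn ℝ (⊤ : ℕ∞) w (Ioi 0) :=
      (hf_cdo' hf).sqrt (fun t ht => (hf_dpos hf ht).ne')
    have hzc : ContDiffOn ℝ (⊤ : ℕ∞) z (Ioi 0) :=
      (hf_cdo hf).div hwc (fun t ht => (wpos t ht).ne')
    exact hzc.rpow_const_of_ne (fun t ht => (zpos t ht).ne')
  have hkd : ∀ t > T0, HasDerivAt (fun t => w t * z t ^ (q - 1))
      (w t ^2 * z t ^ (q-2) * (q - 1 - (α - 1) * R t)) t := by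
    intro t ht
    have ht0 : 0 < t := hT0.trans ht
    have h1 := (hwd t ht0).mul ((hzd t ht0).rpow_const (p := q - 1) (Or.inl (zpos t ht0).ne'))
    refine HasDerivAt.congr_deriv (f := fun t => w t * z t ^ (q - 1)) h1 ?_
    symm
    have e1 : z t ^ (q - 1) = z t ^ (q-2) * z t := by
      rw [← Real.rpow_add_one (zpos t ht0).ne']; ring_nf
    have e2 : q - 1 - 1 = q - 2 := by ring
    rw [e1, e2]
    have e3 : deriv (deriv f) t / (2 * w t) * z t = R t * w t^2 / 2 := by
      have hw0 := (wpos t ht0).ne'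
      simp only [hz]
      have := hRw t ht0
      field_simp
      linarith
    have e4 : deriv (deriv f) t / (2 * w t) * (z t ^ (q-2) * z t) =
      z t ^ (q-2) * (R t * w t^2 / 2) := by rw [← e3]; ring
    rw [e4, hq]
    ring
  obtain ⟨θ, Θ, C1, hC1, hθc, hΘc, hθ0, hΘd, hθ1, hΘ1, hΘ2⟩ := cut_theta (fun t => z t ^ α)
    (fun t => w t * z t ^ (q - 1)) _ (A := A) hT0 hgc hkd
    (fun t ht => by
      have := wpos t (hT0.trans ht); have := zpos t (hT0.trans ht); positivity) hApos.le
    (by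
      intro t ht
      have ht0 : 0 < t := by linarith
      have htT : t ≥ T0 := by linarith
      have zp := zpos t ht0
      rw [((hzd t ht0).rpow_const (p := α) (Or.inl zp.ne')).deriv]
      have e1 : z t ^ (q - 2) = (z t ^ (α - 1))^2 := by
        rw [← Real.rpow_mul_natCast zp.le]; congr 1; push_cast; rw [hq]; ring
      rw [e1]
      obtain ⟨r1, r2⟩ := hev t htT
      change a ≤ R t at r1
      change R t ≤ τ at r2
      have s1 : (1 - R t / 2)^2 ≤ (1 - a/2)^2 := by
        apply pow_le_pow_left₀ <;> linarith
      have s2 : D ≤ q - 1 - (α - 1) * R t := by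
        rw [hD, hq]; nlinarith
      have s3 : α^2 * (1 - a/2)^2 ≤ A * (q - 1 - (α - 1) * R t) := by
        calc α^2 * (1 - a/2)^2 = A * D := by rw [hA]; field_simp
          _ ≤ _ := by gcongr
      calc (w t * (1 - R t / 2) * α * z t ^ (α - 1)) ^ 2
          = (w t ^ 2 * (z t ^ (α-1))^2) * (α^2 * (1 - R t / 2)^2) := by ring
        _ ≤ (w t ^ 2 * (z t ^ (α-1))^2) * (α^2 * (1 - a / 2)^2) := by gcongr
        _ ≤ (w t ^ 2 * (z t ^ (α-1))^2) * (A * (q - 1 - (α - 1) * R t)) := by gcongr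
        _ = _ := by ring)
  obtain ⟨ψ, Ψ, C2, hC2, hψc, hΨc, hψ0, hΨd, hψ1, hΨ1, hΨ2⟩ := cut_theta (fun t : ℝ => t ^ α)
    (fun t => t ^ (q - 1)) (fun t => (q-1) * t ^ (q-1-1)) (T0 := 1) (A := B) one_pos
    (contDiffOn_id.rpow_const_of_ne (fun t ht => (ne_of_gt ht)))
    (fun t ht => Real.hasDerivAt_rpow_const (Or.inl (by linarith)))
    (fun t ht => by positivity) hBpos.le
    (by
      intro t ht
      have ht0 : 0 < t := by linarith
      rw [(Real.hasDerivAt_rpow_const (Or.inl ht0.ne')).deriv]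
      have e1 : t ^ (q - 1 - 1) = (t ^ (α - 1))^2 := by
        rw [← Real.rpow_mul_natCast ht0.le]; congr 1; push_cast; rw [hq]; ring
      rw [e1, hB, hq]
      apply le_of_eq
      rw [← mul_assoc, div_mul_cancel₀ _ h2α.ne']
      ring)
  have hΨ3 : ∀ s > 0, Ψ s ≤ B * s^(q-1) + C2 := by
    intro s hs
    rcases le_total s (1+1) with h | h
    · have := hΨ1 s h
      have : 0 ≤ B * s^(q-1) := by positivity
      linarith
    · exact hΨ2 s h
  set C3 : ℝ := 2^q with hC3
  have hC3p : 0 < C3 := by positivity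
  have hψ3 : ∀ s > 0, s^q - C3 ≤ ψ s^2 := by
    intro s hs
    rcases le_total s (1+1) with h | h
    · have : s^q ≤ 2^q := Real.rpow_le_rpow hs.le (by linarith) (by linarith)
      have := sq_nonneg (ψ s)
      linarith
    · rw [hψ1 s h, ← Real.rpow_mul_natCast hs.le]
      push_cast
      rw [hq, mul_comm α 2]
      linarith
  -- comparison of w z^q with f^p
  set c1 := cg ^ (-(α - 1/2)) with hc1
  have hc1p : 0 < c1 := by positivity
  have hwz : ∀ t > 0, c1 * f t ^ p ≤ w t * z t ^ q := by
    intro t ht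
    have ft := hf_pos hf ht.le
    have dt := hf_dpos hf ht
    have e1 : w t * z t ^ q = f t ^ q * (deriv f t) ^ (-(α - 1/2)) := by
      simp only [hz]
      rw [Real.div_rpow ft.le (wpos t ht).le]
      simp only [hw]
      rw [Real.sqrt_eq_rpow, ← Real.rpow_mul dt.le]
      rw [div_eq_mul_inv (f t ^ q), ← Real.rpow_neg dt.le, mul_left_comm, ← Real.rpow_add dt]
      congr 2
      rw [hq]; ring
    have e2 : (cg * f t ^ τ) ^ (-(α - 1/2)) ≤ (deriv f t) ^ (-(α - 1/2)) :=
      Real.rpow_le_rpow_of_nonpos dt (hgr t ht) (by linarith)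
    rw [e1]
    calc c1 * f t ^ p = f t ^ q * (cg * f t ^ τ) ^ (-(α - 1/2)) := by
          rw [Real.mul_rpow hcg.le (by positivity), ← Real.rpow_mul ft.le, mul_left_comm,
            ← Real.rpow_add ft, hc1]
          congr 2
          rw [hp, hq]; ring
      _ ≤ _ := by gcongr
  obtain ⟨c2, hc2p, hc2⟩ : ∃ c2 : ℝ, 0 < c2 ∧ ∀ t > 0, w t ≤ c2 * f t := by
    have h2 : 0 < τ / 2 := by positivity
    refine ⟨√cg * f 0 ^ (τ/2 - 1), by positivity, fun t ht => ?_⟩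
    have ft := hf_pos hf ht.le
    calc w t ≤ √(cg * f t ^ τ) := Real.sqrt_le_sqrt (hgr t ht)
      _ = √cg * f t ^ (τ/2) := by
          rw [Real.sqrt_mul hcg.le, Real.sqrt_eq_rpow (f t ^ τ), ← Real.rpow_mul ft.le]
          ring_nf
      _ = √cg * (f t ^ (τ/2 - 1) * f t) := by
          rw [← Real.rpow_add_one ft.ne']; ring_nf
      _ ≤ √cg * (f 0 ^ (τ/2 - 1) * f t) := by
          gcongr √cg * (?_ * f t)
          exact Real.rpow_le_rpow_of_nonpos f0 (hf_mono hf le_rfl ht.le) (by linarith)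
      _ = _ := by ring
  set κ := min (ε * ρ * c1) 1 with hκ
  have hκp : 0 < κ := lt_min (by positivity) one_pos
  have hκ1 : κ ≤ ε * ρ * c1 := min_le_left _ _
  have hκ2 : κ ≤ 1 := min_le_right _ _
  set K := c2 * C3 + C2 with hK
  have hKp : 0 < K := by positivity
  obtain ⟨D1, hD1, hD1'⟩ := pow_absorb (b := 1) (q := p) (δ := ε * ρ * c1 / K) one_pos hp1
    (by positivity)
  set F1 := f (T0 + 1) with hF1
  have hF1p : 0 < F1 := hf_pos hf (by linarith)
  obtain ⟨D2, hD2, hD2'⟩ := pow_absorb (b := 1) (q := q) (δ := ε * c / (2 * (ρ * C1 + 1))) one_pos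
    (by linarith) (by positivity)
  obtain ⟨D3, hD3, hD3'⟩ := pow_absorb (b := q - 1) (q := q) (δ := ε * c / (2 * (B * F1)))
    (by linarith) (by linarith) (by positivity)
  have a1 : ∀ x : ℝ, 0 ≤ x → K * x ≤ ε * ρ * c1 * x ^ p + K * D1 := by
    intro x hx
    have := mul_le_mul_of_nonneg_left (hD1' x hx) hKp.le
    rw [Real.rpow_one] at this
    calc K * x ≤ _ := this
      _ = _ := by field_simp
  have a2 : ∀ s : ℝ, 0 ≤ s → (ρ * C1 + 1) * s ≤ ε * c / 2 * s^q + (ρ * C1 + 1) * D2 := by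
    intro x hx
    have hpp : 0 < ρ * C1 + 1 := by positivity
    have := mul_le_mul_of_nonneg_left (hD2' x hx) hpp.le
    rw [Real.rpow_one] at this
    calc (ρ * C1 + 1) * x ≤ _ := this
      _ = _ := by field_simp
  have a3 : ∀ s : ℝ, 0 ≤ s → (B * F1) * s^(q-1) ≤ ε * c / 2 * s^q + (B * F1) * D3 := by
    intro x hx
    have hpp : 0 < B * F1 := by positivity
    have := mul_le_mul_of_nonneg_left (hD3' x hx) hpp.le
    calc (B * F1) * x^(q-1) ≤ _ := this
      _ = _ := by field_simp
  refine ⟨θ, Θ, ψ, Ψ, ρ, ε, κ,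
    K * D1 + (ρ * C1 + 1) * D2 + (B * F1) * D3 + ε * c * C3 + C2 * F1 + F1 ^ p,
    min (T0/2) (1/2), by positivity, hρ, hε, hε1, hκp, hθc, hΘc, hψc, hΨc,
    fun t ht => hθ0 t (ht.trans (min_le_left _ _)),
    fun t ht => hψ0 t (ht.trans (min_le_right _ _)), hΘd, hΨd, ?_⟩
  intro t ht s hs
  have ft := hf_pos hf ht.le
  have wt := wpos t ht
  have zt := zpos t ht
  have hp3 := hψ3 s hs
  have hP3 := hΨ3 s hs
  have t1 : 0 ≤ K * D1 := by positivity
  have t2 : 0 ≤ (ρ * C1 + 1) * D2 := by positivity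
  have t3 : 0 ≤ (B * F1) * D3 := by positivity
  have t4 : 0 ≤ C2 * F1 := by positivity
  have t5 : 0 ≤ F1 ^ p := by positivity
  have b1 : ε * c * (s^q - C3) ≤ ε * c * ψ s^2 := by gcongr
  have b2 := a2 s hs.le
  have b3 := a3 s hs.le
  have b4 : κ * s ≤ 1 * s := by gcongr
  have b5 : 0 ≤ ε * c / 2 * s^q := by positivity
  change _ ≤ ρ * (w t * θ t ^ 2) + (1 - ε) * (w t * ψ s ^ 2) + ε * c * ψ s ^ 2 - κ * f t ^ p - κ * s + _
  rcases le_total (T0 + 1) t with h | h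
  · have hth : θ t ^ 2 = z t ^ q := by
      rw [hθ1 t h, ← Real.rpow_mul_natCast zt.le]
      push_cast
      rw [hq, mul_comm α 2]
    rw [hth]
    have g1 : ρ * (Θ t * s) ≤ ρ * ((A * (w t * z t ^ (q-1)) + C1) * s) := by
      gcongr; exact hΘ2 t h
    have g2 : Ψ s * f t ≤ (B * s^(q-1) + C2) * f t := by gcongr
    have g3 := mul_le_mul_of_nonneg_left (hyoung (z t) s zt.le hs.le) wt.le
    have g4 : (1 - ε) * (w t * (s^q - C3)) ≤ (1 - ε) * (w t * ψ s^2) := by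
      have : 0 ≤ 1 - ε := by linarith
      gcongr
    have g5 := hwz t ht
    have g6 : w t * C3 ≤ c2 * f t * C3 := by
      have := hc2 t ht
      gcongr
    have g7 := a1 (f t) ft.le
    have g8 : κ * f t ^ p ≤ ε * ρ * c1 * f t ^ p := by gcongr
    have g9 : 2 * ε * ρ * (c1 * f t ^ p) ≤ 2 * ε * ρ * (w t * z t ^ q) := by gcongr
    have g10 : 0 ≤ ε * (w t * s^q) := by positivity
    have g11 : 0 ≤ ε * (w t * C3) := by positivity
    have g12 : (B * s^(q-1)) * f t = w t * (B * s^(q-1) * z t) := by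
      have := fwz t ht
      calc (B * s^(q-1)) * f t = (B * s^(q-1)) * (w t * z t) := by rw [← this]
        _ = _ := by ring
    rw [hK] at *
    linarith
  · have g1 : ρ * (Θ t * s) ≤ ρ * (C1 * s) := by
      gcongr; exact hΘ1 t h
    have hfF : f t ≤ F1 := hf_mono hf ht.le h
    have g2 : Ψ s * f t ≤ (B * s^(q-1) + C2) * f t := by gcongr
    have g3 : (B * s^(q-1) + C2) * f t ≤ (B * s^(q-1) + C2) * F1 := by gcongr
    have g4 : 0 ≤ ρ * (w t * θ t ^ 2) := by positivity
    have g5 : 0 ≤ (1 - ε) * (w t * ψ s ^ 2) := by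
      have : 0 ≤ 1 - ε := by linarith
      positivity
    have g6 : κ * f t ^ p ≤ 1 * F1 ^ p := by gcongr
    linarith

end RealPart2


section LapPart
variable {n : ℕ}

/-- Partial derivative in the `i`-th coordinate direction. -/
def pd (i : Fin n) (w : EuclideanSpace ℝ (Fin n) → ℝ) (x : EuclideanSpace ℝ (Fin n)) : ℝ :=
  fderiv ℝ w x (EuclideanSpace.single i (1:ℝ))

lemma pd_cd {w : EuclideanSpace ℝ (Fin n) → ℝ} (hw : ContDiff ℝ (⊤ : ℕ∞) w) (i : Fin n) :
    ContDiff ℝ (⊤ : ℕ∞) (pd i w) := by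
  unfold pd
  exact (hw.fderiv_right (m := (⊤ : ℕ∞)) (by simp)).clm_apply contDiff_const

lemma cd_diff {E : Type*} [NormedAddCommGroup E] [NormedSpace ℝ E] {w : E → ℝ}
    (hw : ContDiff ℝ (⊤ : ℕ∞) w) : Differentiable ℝ w :=
  hw.differentiable (by simp)

lemma lap_eq {w : EuclideanSpace ℝ (Fin n) → ℝ} (hw : ContDiff ℝ (⊤ : ℕ∞) w)
    (x : EuclideanSpace ℝ (Fin n)) : lap w x = ∑ i, pd i (pd i w) x := by
  unfold lap
  refine Finset.sum_congr rfl fun i _ => ?_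
  rw [iteratedFDeriv_two_apply]
  unfold pd
  have h1 : DifferentiableAt ℝ (fderiv ℝ w) x :=
    ((hw.fderiv_right (m := (⊤ : ℕ∞)) (by simp)).differentiable (by simp)) x
  rw [fderiv_clm_apply h1 (differentiableAt_const _)]
  simp

lemma lap_cd {w : EuclideanSpace ℝ (Fin n) → ℝ} (hw : ContDiff ℝ (⊤ : ℕ∞) w) :
    ContDiff ℝ (⊤ : ℕ∞) (lap w) := by
  have : lap w = fun x => ∑ i, pd i (pd i w) x := funext (lap_eq hw)
  rw [this]
  exact ContDiff.sum fun i _ => pd_cd (pd_cd hw i) i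

lemma lap_congr {w v : EuclideanSpace ℝ (Fin n) → ℝ} {x : EuclideanSpace ℝ (Fin n)}
    (h : w =ᶠ[𝓝 x] v) : lap w x = lap v x := by
  unfold lap
  rw [h.iteratedFDeriv ℝ 2 |>.eq_of_nhds]

lemma pd_congr {w v : EuclideanSpace ℝ (Fin n) → ℝ} {x : EuclideanSpace ℝ (Fin n)} (i : Fin n)
    (h : w =ᶠ[𝓝 x] v) : pd i w x = pd i v x := by
  unfold pd
  rw [h.fderiv_eq]

lemma grad_sq (w : EuclideanSpace ℝ (Fin n) → ℝ) (x : EuclideanSpace ℝ (Fin n)) :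
    ‖gradient w x‖ ^ 2 = ∑ i, (pd i w x) ^ 2 := by
  rw [EuclideanSpace.norm_sq_eq]
  refine Finset.sum_congr rfl fun i _ => ?_
  have : pd i w x = gradient w x i := by
    unfold pd
    rw [← toDual_gradient]
    rw [InnerProductSpace.toDual_apply_apply, EuclideanSpace.inner_single_right]
    simp
  rw [this, Real.norm_eq_abs, sq_abs]

lemma pd_comp {w : EuclideanSpace ℝ (Fin n) → ℝ} (hw : ContDiff ℝ (⊤ : ℕ∞) w) {G : ℝ → ℝ}
    (hG : ContDiff ℝ (⊤ : ℕ∞) G) (i : Fin n) (x : EuclideanSpace ℝ (Fin n)) :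
    pd i (fun y => G (w y)) x = deriv G (w x) * pd i w x := by
  unfold pd
  have := ((cd_diff hG (w x)).hasDerivAt.comp_hasFDerivAt x (cd_diff hw x).hasFDerivAt).fderiv
  have e : (fun y => G (w y)) = G ∘ w := rfl
  rw [e, this]
  simp

lemma pd_mul {w v : EuclideanSpace ℝ (Fin n) → ℝ} (hw : ContDiff ℝ (⊤ : ℕ∞) w)
    (hv : ContDiff ℝ (⊤ : ℕ∞) v) (i : Fin n) (x : EuclideanSpace ℝ (Fin n)) :
    pd i (fun y => w y * v y) x = w x * pd i v x + pd i w x * v x := by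
  unfold pd
  rw [fderiv_fun_mul (cd_diff hw x) (cd_diff hv x)]
  simp; ring

lemma cd_deriv {G : ℝ → ℝ} (hG : ContDiff ℝ (⊤ : ℕ∞) G) : ContDiff ℝ (⊤ : ℕ∞) (deriv G) :=
  ((contDiff_infty_iff_deriv (𝕜 := ℝ)).1 hG).2

lemma lap_comp {w : EuclideanSpace ℝ (Fin n) → ℝ} (hw : ContDiff ℝ (⊤ : ℕ∞) w) {G : ℝ → ℝ}
    (hG : ContDiff ℝ (⊤ : ℕ∞) G) (x : EuclideanSpace ℝ (Fin n)) :
    lap (fun y => G (w y)) x =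
      deriv G (w x) * lap w x + deriv (deriv G) (w x) * ∑ i, (pd i w x) ^ 2 := by
  have h1 : ContDiff ℝ (⊤ : ℕ∞) (fun y => G (w y)) := hG.comp hw
  have h2 : ContDiff ℝ (⊤ : ℕ∞) (fun y => deriv G (w y)) := (cd_deriv hG).comp hw
  rw [lap_eq h1, lap_eq hw, Finset.mul_sum, Finset.mul_sum, ← Finset.sum_add_distrib]
  refine Finset.sum_congr rfl fun i _ => ?_
  have e : pd i (fun y => G (w y)) = fun y => deriv G (w y) * pd i w y :=
    funext fun y => pd_comp hw hG i y
  rw [e, pd_mul h2 (pd_cd hw i), pd_comp hw (cd_deriv hG)]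
  ring

lemma line_deriv {w : EuclideanSpace ℝ (Fin n) → ℝ} (hw : ContDiff ℝ (⊤ : ℕ∞) w) (i : Fin n)
    (x : EuclideanSpace ℝ (Fin n)) (t : ℝ) :
    HasDerivAt (fun t : ℝ => w (x + t • EuclideanSpace.single i (1:ℝ)))
      (pd i w (x + t • EuclideanSpace.single i (1:ℝ))) t := by
  have h1 : HasDerivAt (fun t : ℝ => x + t • EuclideanSpace.single i (1:ℝ))
      (EuclideanSpace.single i (1:ℝ)) t := by
    simpa using ((hasDerivAt_id t).smul_const (EuclideanSpace.single i (1:ℝ))).const_add x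
  exact (cd_diff hw _).hasFDerivAt.comp_hasDerivAt t h1

lemma pd2_nonneg {w : EuclideanSpace ℝ (Fin n) → ℝ} (hw : ContDiff ℝ (⊤ : ℕ∞) w) (i : Fin n)
    {x : EuclideanSpace ℝ (Fin n)} (hmin : IsLocalMin w x) : 0 ≤ pd i (pd i w) x := by
  by_contra hneg
  push Not at hneg
  set g : ℝ → ℝ := fun t : ℝ => w (x + t • EuclideanSpace.single i (1:ℝ)) with hg
  have hc : Continuous (fun t : ℝ => x + t • EuclideanSpace.single i (1:ℝ)) := by fun_prop
  have ht : Tendsto (fun t : ℝ => x + t • EuclideanSpace.single i (1:ℝ)) (𝓝 0) (𝓝 x) := by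
    have := hc.tendsto 0
    simpa using this
  have hgm : IsLocalMin g 0 := by
    have := ht.eventually hmin
    filter_upwards [this] with t h
    simpa [hg] using h
  have d1 : deriv g = fun t => pd i w (x + t • EuclideanSpace.single i (1:ℝ)) :=
    funext fun t => (line_deriv hw i x t).deriv
  have d2 : deriv (deriv g) 0 = pd i (pd i w) x := by
    rw [d1, (line_deriv (pd_cd hw i) i x 0).deriv]; simp
  have hmax : IsLocalMax g 0 := by
    apply isLocalMax_of_deriv_deriv_neg
    · rw [d2]; exact hneg
    · exact hgm.deriv_eq_zero
    · exact (line_deriv hw i x 0).continuousAt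
  have hconst : g =ᶠ[𝓝 0] fun _ => g 0 := by
    filter_upwards [hgm, hmax] with t h1 h2
    exact le_antisymm h2 h1
  have h3 : deriv g =ᶠ[𝓝 0] fun _ => 0 := by
    have := hconst.deriv
    simpa using this
  have h4 := h3.deriv_eq
  rw [d2] at h4
  simp at h4
  linarith

lemma max_principle {Ω : Set (EuclideanSpace ℝ (Fin n))} (hΩ : GoodDomain Ω)
    {w : EuclideanSpace ℝ (Fin n) → ℝ} (hw : ContDiff ℝ (⊤ : ℕ∞) w)
    (hb : ∀ x ∈ frontier Ω, w x = 0) (hl : ∀ x ∈ Ω, lap w x < 0) : ∀ x ∈ Ω, 0 < w x := by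
  obtain ⟨ho, hbd, hne⟩ := hΩ
  have key : ∀ x ∈ Ω, ¬ (∀ y ∈ closure Ω, w x ≤ w y) := by
    intro x hx hmin
    have : IsLocalMin w x := by
      filter_upwards [ho.mem_nhds hx] with y hy
      exact hmin y (subset_closure hy)
    have h1 := hl x hx
    rw [lap_eq hw] at h1
    have : 0 ≤ ∑ i, pd i (pd i w) x := Finset.sum_nonneg fun i _ => pd2_nonneg hw i this
    linarith
  intro x hx
  by_contra h
  push Not at h
  obtain ⟨x0, hx0, hm⟩ := hbd.isCompact_closure.exists_isMinOn (hne.closure)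
    (hw.continuous.continuousOn)
  by_cases h0 : x0 ∈ Ω
  · exact key x0 h0 (fun y hy => hm hy)
  · have hf : x0 ∈ frontier Ω := by
      rw [ho.frontier_eq]; exact ⟨hx0, h0⟩
    refine key x hx (fun y hy => ?_)
    have : w x0 ≤ w y := hm hy
    rw [hb x0 hf] at this
    linarith

lemma ibp_pd {φ v : EuclideanSpace ℝ (Fin n) → ℝ} (hφ : ContDiff ℝ (⊤ : ℕ∞) φ)
    (hc : HasCompactSupport φ) (hv : ContDiff ℝ (⊤ : ℕ∞) v) (i : Fin n) :
    ∫ x, φ x * pd i v x = - ∫ x, pd i φ x * v x := by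
  have hc' : HasCompactSupport (pd i φ) := hc.fderiv_apply ℝ _
  apply integral_mul_fderiv_eq_neg_fderiv_mul_of_integrable
  · exact ((pd_cd hφ i).continuous.mul hv.continuous).integrable_of_hasCompactSupport hc'.mul_right
  · exact (hφ.continuous.mul (pd_cd hv i).continuous).integrable_of_hasCompactSupport hc.mul_right
  · exact (hφ.continuous.mul hv.continuous).integrable_of_hasCompactSupport hc.mul_right
  · exact fun x _ => cd_diff hφ x
  · exact fun x _ => cd_diff hv x

lemma ibp_lap {φ v : EuclideanSpace ℝ (Fin n) → ℝ} (hφ : ContDiff ℝ (⊤ : ℕ∞) φ)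
    (hc : HasCompactSupport φ) (hv : ContDiff ℝ (⊤ : ℕ∞) v) :
    ∫ x, ∑ i, pd i φ x * pd i v x = - ∫ x, φ x * lap v x := by
  have hc' : ∀ i, HasCompactSupport (pd i φ) := fun i => hc.fderiv_apply ℝ _
  have e : (fun x => φ x * lap v x) = fun x => ∑ i, φ x * pd i (pd i v) x := by
    funext x; rw [lap_eq hv, Finset.mul_sum]
  rw [e, integral_finsetSum, integral_finsetSum, ← Finset.sum_neg_distrib]
  · refine Finset.sum_congr rfl fun i _ => ?_
    rw [ibp_pd hφ hc (pd_cd hv i), neg_neg]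
  · intro i _
    exact (hφ.continuous.mul (pd_cd (pd_cd hv i) i).continuous).integrable_of_hasCompactSupport
      hc.mul_right
  · intro i _
    exact ((pd_cd hφ i).continuous.mul (pd_cd hv i).continuous).integrable_of_hasCompactSupport
      (hc' i).mul_right

end LapPart


section ExtPart
variable {n : ℕ} {Ω : Set (EuclideanSpace ℝ (Fin n))}

/-- Extension by zero of `G ∘ w` outside `Ω`. -/
def ext0 (Ω : Set (EuclideanSpace ℝ (Fin n))) (G : ℝ → ℝ) (w : EuclideanSpace ℝ (Fin n) → ℝ) :
    EuclideanSpace ℝ (Fin n) → ℝ := Ω.indicator (fun x => G (w x))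

lemma ext0_in {G : ℝ → ℝ} {w : EuclideanSpace ℝ (Fin n) → ℝ} {x : EuclideanSpace ℝ (Fin n)}
    (hx : x ∈ Ω) : ext0 Ω G w x = G (w x) := indicator_of_mem hx _

lemma ext0_out {G : ℝ → ℝ} {w : EuclideanSpace ℝ (Fin n) → ℝ} {x : EuclideanSpace ℝ (Fin n)}
    (hx : x ∉ Ω) : ext0 Ω G w x = 0 := indicator_of_notMem hx _

lemma ext0_nhds (ho : IsOpen Ω) {G : ℝ → ℝ} {w : EuclideanSpace ℝ (Fin n) → ℝ}
    {x : EuclideanSpace ℝ (Fin n)} (hx : x ∈ Ω) : ext0 Ω G w =ᶠ[𝓝 x] fun y => G (w y) := by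
  filter_upwards [ho.mem_nhds hx] with y hy using ext0_in hy

lemma ext0_supp (hΩ : GoodDomain Ω) {G : ℝ → ℝ} {w : EuclideanSpace ℝ (Fin n) → ℝ} {T : ℝ}
    (hT : 0 < T) (hw : Continuous w) (hb : ∀ x ∈ frontier Ω, w x = 0)
    (hG : ∀ t ≤ T, G t = 0) : tsupport (ext0 Ω G w) ⊆ Ω := by
  obtain ⟨ho, hbd, hne⟩ := hΩ
  have h1 : tsupport (ext0 Ω G w) ⊆ closure Ω ∩ {x | T ≤ w x} := by
    apply closure_minimal
    · intro x hx
      have hxΩ : x ∈ Ω := by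
        by_contra h
        exact hx (ext0_out h)
      refine ⟨subset_closure hxΩ, ?_⟩
      by_contra h
      simp only [mem_ofPred_eq, not_le] at h
      apply hx
      rw [ext0_in hxΩ]
      exact hG _ h.le
    · exact isClosed_closure.inter (isClosed_le continuous_const hw)
  intro x hx
  by_contra h
  have h2 := h1 hx
  have : x ∈ frontier Ω := by rw [ho.frontier_eq]; exact ⟨h2.1, h⟩
  have h3 : T ≤ w x := h2.2
  rw [hb x this] at h3
  linarith

lemma ext0_compact (hΩ : GoodDomain Ω) {φ : EuclideanSpace ℝ (Fin n) → ℝ}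
    (h : tsupport φ ⊆ Ω) : HasCompactSupport φ :=
  Metric.isCompact_of_isClosed_isBounded (isClosed_tsupport _) (hΩ.2.1.subset h)

lemma ext0_cd (hΩ : GoodDomain Ω) {G : ℝ → ℝ} {w : EuclideanSpace ℝ (Fin n) → ℝ}
    (hw : ContDiff ℝ (⊤ : ℕ∞) w) (hGc : ContDiff ℝ (⊤ : ℕ∞) G)
    (hs : tsupport (ext0 Ω G w) ⊆ Ω) : ContDiff ℝ (⊤ : ℕ∞) (ext0 Ω G w) := by
  rw [contDiff_iff_contDiffAt]
  intro x
  by_cases hx : x ∈ Ω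
  · exact ((hGc.comp hw).contDiffAt).congr_of_eventuallyEq (ext0_nhds hΩ.1 hx)
  · have : x ∉ tsupport (ext0 Ω G w) := fun h => hx (hs h)
    rw [notMem_tsupport_iff_eventuallyEq] at this
    exact (contDiffAt_const (c := (0:ℝ))).congr_of_eventuallyEq this

lemma pd_out {φ : EuclideanSpace ℝ (Fin n) → ℝ} (hs : tsupport φ ⊆ Ω) (i : Fin n)
    {x : EuclideanSpace ℝ (Fin n)} (hx : x ∉ Ω) : pd i φ x = 0 := by
  have : x ∉ tsupport φ := fun h => hx (hs h)
  rw [notMem_tsupport_iff_eventuallyEq] at this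
  rw [pd_congr i this]
  simp [pd]

lemma lap_out {φ : EuclideanSpace ℝ (Fin n) → ℝ} (hφ : ContDiff ℝ (⊤ : ℕ∞) φ)
    (hs : tsupport φ ⊆ Ω)
    {x : EuclideanSpace ℝ (Fin n)} (hx : x ∉ Ω) : lap φ x = 0 := by
  rw [lap_eq hφ]
  refine Finset.sum_eq_zero fun i _ => ?_
  have h2 : tsupport (pd i φ) ⊆ Ω := (tsupport_fderiv_apply_subset ℝ _).trans hs
  exact pd_out h2 i hx

lemma energy (hΩ : GoodDomain Ω) {θ Θ : ℝ → ℝ} {w : EuclideanSpace ℝ (Fin n) → ℝ} {T : ℝ}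
    (hT : 0 < T) (hw : ContDiff ℝ (⊤ : ℕ∞) w) (hb : ∀ x ∈ frontier Ω, w x = 0)
    (hθ : ContDiff ℝ (⊤ : ℕ∞) θ) (hΘ : ContDiff ℝ (⊤ : ℕ∞) Θ) (h0 : ∀ t ≤ T, θ t = 0 ∧ Θ t = 0)
    (hd : ∀ t, HasDerivAt Θ ((deriv θ t)^2) t) :
    ∫ x in Ω, ‖gradient (ext0 Ω θ w) x‖ ^ 2 = ∫ x in Ω, Θ (w x) * (- lap w x) := by
  have s1 := ext0_supp hΩ hT hw.continuous hb (fun t ht => (h0 t ht).1)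
  have s2 := ext0_supp hΩ hT hw.continuous hb (fun t ht => (h0 t ht).2)
  have e1 : ∀ x, ‖gradient (ext0 Ω θ w) x‖ ^ 2 = ∑ i, pd i (ext0 Ω Θ w) x * pd i w x := by
    intro x
    rw [grad_sq]
    refine Finset.sum_congr rfl fun i _ => ?_
    by_cases hx : x ∈ Ω
    · rw [pd_congr i (ext0_nhds hΩ.1 hx), pd_congr i (ext0_nhds hΩ.1 hx), pd_comp hw hθ,
        pd_comp hw hΘ, (hd _).deriv]
      ring
    · rw [pd_out s1 i hx, pd_out s2 i hx]; simp
  rw [setIntegral_eq_integral_of_forall_compl_eq_zero]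
  · simp_rw [e1]
    rw [ibp_lap (ext0_cd hΩ hw hΘ s2) (ext0_compact hΩ s2) hw, ← integral_neg,
      ← integral_indicator hΩ.1.measurableSet]
    congr 1
    funext x
    by_cases hx : x ∈ Ω
    · rw [indicator_of_mem hx, ext0_in hx]; ring
    · rw [indicator_of_notMem hx, ext0_out hx]; ring
  · intro x hx
    rw [grad_sq]
    exact Finset.sum_eq_zero fun i _ => by rw [pd_out s1 i hx]; simp

lemma grad_cont {φ : EuclideanSpace ℝ (Fin n) → ℝ} (hφ : ContDiff ℝ (⊤ : ℕ∞) φ) :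
    Continuous (fun x => ‖gradient φ x‖ ^ 2) := by
  simp_rw [grad_sq]
  exact continuous_finsetSum _ fun i _ => (pd_cd hφ i).continuous.pow 2

lemma poincare (hΩ : GoodDomain Ω) {R : ℝ} (hR : ∀ x ∈ Ω, ‖x‖ ≤ R) (i : Fin n)
    {φ : EuclideanSpace ℝ (Fin n) → ℝ} (hφ : ContDiff ℝ (⊤ : ℕ∞) φ) (hs : tsupport φ ⊆ Ω) :
    ∫ x in Ω, φ x ^ 2 ≤ 4 * R ^ 2 * ∫ x in Ω, ‖gradient φ x‖ ^ 2 := by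
  have hc := ext0_compact hΩ hs
  have hφ2 : ContDiff ℝ (⊤ : ℕ∞) (fun x => φ x ^ 2) := hφ.pow 2
  have hc2 : HasCompactSupport (fun x => φ x ^ 2) := by
    apply HasCompactSupport.intro hc
    intro x hx
    rw [image_eq_zero_of_notMem_tsupport hx]; simp
  have hz : ∀ x, x ∉ Ω → φ x = 0 := fun x hx => image_eq_zero_of_notMem_tsupport (fun h => hx (hs h))
  set v : EuclideanSpace ℝ (Fin n) → ℝ := fun x => x i with hv
  have hvc : ContDiff ℝ (⊤ : ℕ∞) v := by
    have : v = (EuclideanSpace.proj i : EuclideanSpace ℝ (Fin n) →L[ℝ] ℝ) := by ext x; simp [hv]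
    rw [this]; exact ContinuousLinearMap.contDiff _
  have hv1 : ∀ x, pd i v x = 1 := by
    intro x
    have : v = (EuclideanSpace.proj i : EuclideanSpace ℝ (Fin n) →L[ℝ] ℝ) := by ext x; simp [hv]
    rw [pd, this, ContinuousLinearMap.fderiv]; simp
  have h1 := ibp_pd hφ2 hc2 hvc i
  simp_rw [hv1, mul_one] at h1
  have e2 : ∀ x, pd i (fun x => φ x ^ 2) x = 2 * φ x * pd i φ x := by
    intro x
    have e : (fun x => φ x ^ 2) = fun x => φ x * φ x := by funext x; ring
    rw [e, pd_mul hφ hφ]; ring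
  simp_rw [e2] at h1
  have hgz : ∀ x, x ∉ Ω → ‖gradient φ x‖ ^ 2 = 0 := by
    intro x hx
    rw [grad_sq]
    exact Finset.sum_eq_zero fun i _ => by rw [pd_out hs i hx]; simp
  rw [setIntegral_eq_integral_of_forall_compl_eq_zero (fun x hx => by rw [hz x hx]; simp),
    setIntegral_eq_integral_of_forall_compl_eq_zero (fun x hx => hgz x hx)]
  have hgc : HasCompactSupport (fun x => ‖gradient φ x‖ ^ 2) := by
    apply HasCompactSupport.intro hc
    intro x hx
    rw [grad_sq]
    refine Finset.sum_eq_zero fun i _ => ?_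
    rw [notMem_tsupport_iff_eventuallyEq] at hx
    rw [pd_congr i hx]; simp [pd]
  have i1 : Integrable (fun x => φ x ^ 2) := hφ2.continuous.integrable_of_hasCompactSupport hc2
  have i2 : Integrable (fun x => ‖gradient φ x‖ ^ 2) :=
    (grad_cont hφ).integrable_of_hasCompactSupport hgc
  have h2 : ∫ x, φ x ^ 2 ≤ ∫ x, (1/2 * φ x ^ 2 + 2 * R^2 * ‖gradient φ x‖ ^ 2) := by
    rw [h1, ← integral_neg]
    apply integral_mono
    · apply Integrable.neg
      refine Continuous.integrable_of_hasCompactSupport ?_ ?_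
      · exact ((continuous_const.mul hφ.continuous).mul (pd_cd hφ i).continuous).mul hvc.continuous
      · apply HasCompactSupport.intro hc
        intro x hx
        rw [image_eq_zero_of_notMem_tsupport hx]; simp
    · exact (i1.const_mul _).add (i2.const_mul _)
    · intro x
      simp only
      by_cases hx : x ∈ Ω
      · have hxR : |x i| ≤ R := by
          have := EuclideanSpace.norm_sq_eq x
          have h3 : ‖x i‖ ≤ ‖x‖ := PiLp.norm_apply_le x i
          rw [Real.norm_eq_abs] at h3
          exact h3.trans (hR x hx)
        have h4 : (x i)^2 ≤ R^2 := by
          rw [← sq_abs]; exact pow_le_pow_left₀ (abs_nonneg _) hxR 2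
        have h5 : pd i φ x ^ 2 ≤ ‖gradient φ x‖ ^ 2 := by
          rw [grad_sq]
          exact Finset.single_le_sum (f := fun i => pd i φ x ^ 2) (fun j _ => sq_nonneg _)
            (Finset.mem_univ i)
        have h6 : (x i)^2 * pd i φ x ^ 2 ≤ R^2 * ‖gradient φ x‖ ^ 2 := by gcongr
        have h7 := sq_nonneg (φ x + 2 * (x i * pd i φ x))
        simp only [hv]
        nlinarith
      · rw [hz x hx, hgz x hx]; simp
  rw [integral_add (i1.const_mul _) (i2.const_mul _), integral_const_mul, integral_const_mul] at h2
  linarith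

/-- Continuous and bounded on `Ω`. -/
def BC (Ω : Set (EuclideanSpace ℝ (Fin n))) (g : EuclideanSpace ℝ (Fin n) → ℝ) : Prop :=
  ContinuousOn g Ω ∧ ∃ B, ∀ x ∈ Ω, |g x| ≤ B

lemma BC.int (hΩ : GoodDomain Ω) {g : EuclideanSpace ℝ (Fin n) → ℝ} (h : BC Ω g) :
    IntegrableOn g Ω := by
  obtain ⟨hc, B, hB⟩ := h
  have : IsFiniteMeasure (volume.restrict Ω) := ⟨by
    rw [Measure.restrict_apply_univ]; exact hΩ.2.1.measure_lt_top⟩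
  refine Integrable.of_bound (hc.aestronglyMeasurable hΩ.1.measurableSet) B ?_
  rw [ae_restrict_iff' hΩ.1.measurableSet]
  exact Eventually.of_forall hB

lemma BC.mul {g h : EuclideanSpace ℝ (Fin n) → ℝ} (hg : BC Ω g) (hh : BC Ω h) :
    BC Ω (fun x => g x * h x) := by
  obtain ⟨hc, B, hB⟩ := hg
  obtain ⟨hc', B', hB'⟩ := hh
  refine ⟨hc.mul hc', B * B', fun x hx => ?_⟩
  rw [abs_mul]
  have := hB x hx
  have := hB' x hx
  have := abs_nonneg (g x)
  gcongr
  linarith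

lemma BC.add {g h : EuclideanSpace ℝ (Fin n) → ℝ} (hg : BC Ω g) (hh : BC Ω h) :
    BC Ω (fun x => g x + h x) := by
  obtain ⟨hc, B, hB⟩ := hg
  obtain ⟨hc', B', hB'⟩ := hh
  refine ⟨hc.add hc', B + B', fun x hx => ?_⟩
  exact (abs_add_le _ _).trans (add_le_add (hB x hx) (hB' x hx))

lemma BC.of_cont (hΩ : GoodDomain Ω) {g : EuclideanSpace ℝ (Fin n) → ℝ} (hg : Continuous g) :
    BC Ω g := by
  refine ⟨hg.continuousOn, ?_⟩
  obtain ⟨B, hB⟩ := hΩ.2.1.isCompact_closure.exists_bound_of_continuousOn hg.continuousOn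
  exact ⟨B, fun x hx => hB x (subset_closure hx)⟩

end ExtPart


section SolPart
variable {n : ℕ} {Ω : Set (EuclideanSpace ℝ (Fin n))}

/-- The second order system equivalent to the fourth order problem. -/
structure SolP (Ω : Set (EuclideanSpace ℝ (Fin n))) (f : ℝ → ℝ) (L : ℝ)
    (u V : EuclideanSpace ℝ (Fin n) → ℝ) : Prop where
  Lpos : 0 < L
  ucd : ContDiff ℝ (⊤ : ℕ∞) u
  Vcd : ContDiff ℝ (⊤ : ℕ∞) V
  ub : ∀ x ∈ frontier Ω, u x = 0
  Vb : ∀ x ∈ frontier Ω, V x = 0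
  lapu : ∀ x, lap u x = - (L * V x)
  lapV : ∀ x ∈ Ω, lap V x = - (L * f (u x))
  upos : ∀ x ∈ Ω, 0 < u x
  Vpos : ∀ x ∈ Ω, 0 < V x

lemma solP_of {f : ℝ → ℝ} (hf : HypH ⊤ f) (hΩ : GoodDomain Ω) {lam : ℝ} (hl : 0 < lam)
    {u : EuclideanSpace ℝ (Fin n) → ℝ} (hs : Solves Ω ⊤ lam f u) :
    ∃ V, SolP Ω f (√lam) u V := by
  obtain ⟨hu, hpos, heq, hb1, hb2⟩ := hs
  set L := √lam with hL
  have hLp : 0 < L := Real.sqrt_pos.2 hl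
  have hLL : L * L = lam := Real.mul_self_sqrt hl.le
  set V : EuclideanSpace ℝ (Fin n) → ℝ := fun x => (fun t : ℝ => (-1 / L) * t) (lap u x) with hV
  have hG : ContDiff ℝ (⊤ : ℕ∞) (fun t : ℝ => (-1 / L) * t) := by fun_prop
  have hVc : ContDiff ℝ (⊤ : ℕ∞) V := hG.comp (lap_cd hu)
  have hVb : ∀ x ∈ frontier Ω, V x = 0 := by
    intro x hx; simp [hV, hb2 x hx]
  have h1 : ∀ x, lap u x = - (L * V x) := by
    intro x; simp only [hV]; field_simp
  have hd : deriv (fun t : ℝ => (-1 / L) * t) = fun _ => -1 / L := by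
    funext t; rw [deriv_const_mul_field]; simp
  have h2 : ∀ x ∈ Ω, lap V x = - (L * f (u x)) := by
    intro x hx
    rw [hV, lap_comp (lap_cd hu) hG, hd, heq x hx, ← hLL]
    simp
    field_simp
  have h3 : ∀ x ∈ Ω, 0 < V x := by
    apply max_principle hΩ hVc hVb
    intro x hx
    rw [h2 x hx]
    have := mul_pos hLp (hf_pos hf (hpos x hx).1)
    linarith
  refine ⟨V, hLp, hu, hVc, hb1, hVb, h1, h2, ?_, h3⟩
  apply max_principle hΩ hu hb1
  intro x hx
  rw [h1 x]
  have := mul_pos hLp (h3 x hx)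
  linarith

lemma bc_f {f : ℝ → ℝ} (hf : HypH ⊤ f) (hΩ : GoodDomain Ω) {L : ℝ}
    {u V : EuclideanSpace ℝ (Fin n) → ℝ} (h : SolP Ω f L u V) :
    BC Ω (fun x => f (u x)) := by
  have h1 : ContinuousOn f (Ioi 0) := (hf_cdo hf).continuousOn
  refine ⟨h1.comp h.ucd.continuous.continuousOn (fun x hx => h.upos x hx), ?_⟩
  obtain ⟨_, B, hB⟩ := BC.of_cont hΩ h.ucd.continuous
  refine ⟨f B, fun x hx => ?_⟩
  have := h.upos x hx
  rw [abs_of_pos (hf_pos hf this.le)]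
  exact hf_mono hf this.le ((le_abs_self _).trans (hB x hx))

lemma bc_w {f : ℝ → ℝ} (hf : HypH ⊤ f) (hΩ : GoodDomain Ω) {L : ℝ}
    {u V : EuclideanSpace ℝ (Fin n) → ℝ} (h : SolP Ω f L u V) :
    BC Ω (fun x => √(deriv f (u x))) := by
  have h1 : ContinuousOn (deriv f) (Ioi 0) := (hf_cdo' hf).continuousOn
  refine ⟨(h1.comp h.ucd.continuous.continuousOn (fun x hx => h.upos x hx)).sqrt, ?_⟩
  obtain ⟨_, B, hB⟩ := BC.of_cont hΩ h.ucd.continuous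
  refine ⟨√(deriv f B), fun x hx => ?_⟩
  have := h.upos x hx
  rw [abs_of_nonneg (Real.sqrt_nonneg _)]
  exact Real.sqrt_le_sqrt (hf_dmono hf this ((le_abs_self _).trans (hB x hx)))

lemma bc_fp {f : ℝ → ℝ} (hf : HypH ⊤ f) (hΩ : GoodDomain Ω) {L p : ℝ} (hp : 0 ≤ p)
    {u V : EuclideanSpace ℝ (Fin n) → ℝ} (h : SolP Ω f L u V) :
    BC Ω (fun x => f (u x) ^ p) := by
  obtain ⟨h1, B, hB⟩ := bc_f hf hΩ h
  refine ⟨h1.rpow_const (fun x hx => Or.inr hp), B ^ p, fun x hx => ?_⟩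
  have h2 := hf_pos hf (h.upos x hx).le
  rw [abs_of_nonneg (by positivity)]
  exact Real.rpow_le_rpow h2.le ((le_abs_self _).trans (hB x hx)) hp

lemma int_fsub {α : Type*} [MeasurableSpace α] {μ : Measure α} {g h : α → ℝ}
    (hg : Integrable g μ) (hh : Integrable h μ) : Integrable (fun x => g x - h x) μ := hg.sub hh

lemma energy_bound {f : ℝ → ℝ} (hf : HypH ⊤ f) (hΩ : GoodDomain Ω) {lam : ℝ} (i : Fin n)
    {u V : EuclideanSpace ℝ (Fin n) → ℝ} (h : SolP Ω f (√lam) u V) (hst : StabIneq Ω lam f u)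
    {R : ℝ} (hR0 : 0 < R) (hR : ∀ x ∈ Ω, ‖x‖ ≤ R)
    {θ Θ ψ Ψ : ℝ → ℝ} {ρ ε κ C T c p : ℝ} (hT : 0 < T) (hρ : 0 < ρ) (hε : 0 < ε) (hε1 : ε < 1)
    (hp : 0 ≤ p)
    (hθc : ContDiff ℝ (⊤ : ℕ∞) θ) (hΘc : ContDiff ℝ (⊤ : ℕ∞) Θ)
    (hψc : ContDiff ℝ (⊤ : ℕ∞) ψ) (hΨc : ContDiff ℝ (⊤ : ℕ∞) Ψ)
    (hθ0 : ∀ t ≤ T, θ t = 0 ∧ Θ t = 0) (hψ0 : ∀ t ≤ T, ψ t = 0 ∧ Ψ t = 0)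
    (hΘd : ∀ t, HasDerivAt Θ ((deriv θ t)^2) t) (hΨd : ∀ t, HasDerivAt Ψ ((deriv ψ t)^2) t)
    (hkey : ∀ t > 0, ∀ s > 0, ρ * (Θ t * s) + Ψ s * f t ≤
        ρ * (√(deriv f t) * θ t ^ 2) + (1 - ε) * (√(deriv f t) * ψ s ^ 2) + ε * c * ψ s ^ 2
          - κ * f t ^ p - κ * s + C)
    (hc : c * (4 * R ^ 2 * √lam) ≤ 1) :
    κ * (∫ x in Ω, f (u x) ^ p) + κ * (∫ x in Ω, V x) ≤ C * volume.real Ω := by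
  set L := √lam with hL
  have hLp := h.Lpos
  have uc := h.ucd.continuous
  have Vc := h.Vcd.continuous
  -- test (I)
  have I : ∫ x in Ω, √(deriv f (u x)) * θ (u x) ^ 2 ≤ ∫ x in Ω, Θ (u x) * V x := by
    have s1 := ext0_supp hΩ hT uc h.ub (fun t ht => (hθ0 t ht).1)
    have h1 := hst _ (ext0_cd hΩ h.ucd hθc s1) (ext0_compact hΩ s1) s1
    rw [energy hΩ hT h.ucd h.ub hθc hΘc hθ0 hΘd] at h1
    have e1 : ∫ x in Ω, √(deriv f (u x)) * (ext0 Ω θ u x) ^ 2 =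
        ∫ x in Ω, √(deriv f (u x)) * θ (u x) ^ 2 :=
      setIntegral_congr_fun hΩ.1.measurableSet (fun x hx => by simp only [ext0_in hx])
    have e2 : ∫ x in Ω, Θ (u x) * (- lap u x) = L * ∫ x in Ω, Θ (u x) * V x := by
      rw [← integral_const_mul]
      congr 1
      funext x
      rw [h.lapu]; ring
    rw [e1, e2] at h1
    exact le_of_mul_le_mul_left h1 hLp
  have s1 := ext0_supp hΩ hT Vc h.Vb (fun t ht => (hψ0 t ht).1)
  have hcd := ext0_cd hΩ h.Vcd hψc s1
  have e2 : ∫ x in Ω, ‖gradient (ext0 Ω ψ V) x‖ ^ 2 = L * ∫ x in Ω, Ψ (V x) * f (u x) := by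
    rw [energy hΩ hT h.Vcd h.Vb hψc hΨc hψ0 hΨd, ← integral_const_mul]
    refine setIntegral_congr_fun hΩ.1.measurableSet (fun x hx => ?_)
    rw [h.lapV x hx]; ring
  have II : ∫ x in Ω, √(deriv f (u x)) * ψ (V x) ^ 2 ≤ ∫ x in Ω, Ψ (V x) * f (u x) := by
    have h1 := hst _ hcd (ext0_compact hΩ s1) s1
    have e1 : ∫ x in Ω, √(deriv f (u x)) * (ext0 Ω ψ V x) ^ 2 =
        ∫ x in Ω, √(deriv f (u x)) * ψ (V x) ^ 2 :=
      setIntegral_congr_fun hΩ.1.measurableSet (fun x hx => by simp only [ext0_in hx])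
    rw [e1, e2] at h1
    exact le_of_mul_le_mul_left h1 hLp
  have nn : 0 ≤ ∫ x in Ω, ‖gradient (ext0 Ω ψ V) x‖ ^ 2 := integral_nonneg fun x => by positivity
  have n2 : 0 ≤ ∫ x in Ω, Ψ (V x) * f (u x) := by
    rw [e2] at nn
    exact nonneg_of_mul_nonneg_right nn hLp
  have n3 : 0 ≤ ∫ x in Ω, ψ (V x) ^ 2 := integral_nonneg fun x => by positivity
  have III : c * ∫ x in Ω, ψ (V x) ^ 2 ≤ ∫ x in Ω, Ψ (V x) * f (u x) := by
    rcases le_total c 0 with hc0 | hc0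
    · exact (mul_nonpos_of_nonpos_of_nonneg hc0 n3).trans n2
    have h1 := poincare hΩ hR i hcd s1
    have e1 : ∫ x in Ω, (ext0 Ω ψ V x) ^ 2 = ∫ x in Ω, ψ (V x) ^ 2 :=
      setIntegral_congr_fun hΩ.1.measurableSet (fun x hx => by simp only [ext0_in hx])
    rw [e1, e2] at h1
    calc c * ∫ x in Ω, ψ (V x) ^ 2 ≤ c * (4 * R ^ 2 * (L * ∫ x in Ω, Ψ (V x) * f (u x))) := by gcongr
      _ = c * (4 * R ^ 2 * L) * ∫ x in Ω, Ψ (V x) * f (u x) := by ring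
      _ ≤ 1 * ∫ x in Ω, Ψ (V x) * f (u x) := by gcongr
      _ = _ := one_mul _
  -- integrability
  have bf := bc_f hf hΩ h
  have bw := bc_w hf hΩ h
  have bθ : BC Ω (fun x => θ (u x) ^ 2) := BC.of_cont hΩ ((hθc.continuous.comp uc).pow 2)
  have bψ : BC Ω (fun x => ψ (V x) ^ 2) := BC.of_cont hΩ ((hψc.continuous.comp Vc).pow 2)
  have bΘ : BC Ω (fun x => Θ (u x)) := BC.of_cont hΩ (hΘc.continuous.comp uc)
  have bΨ : BC Ω (fun x => Ψ (V x)) := BC.of_cont hΩ (hΨc.continuous.comp Vc)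
  have bV : BC Ω V := BC.of_cont hΩ Vc
  have i1 := ((bΘ.mul bV).int hΩ).const_mul ρ
  have i2 := (bΨ.mul bf).int hΩ
  have i3 := ((bw.mul bθ).int hΩ).const_mul ρ
  have i4 := ((bw.mul bψ).int hΩ).const_mul (1 - ε)
  have i5 := (bψ.int hΩ).const_mul (ε * c)
  have i6 := ((bc_fp hf hΩ hp h).int hΩ).const_mul κ
  have i7 := (bV.int hΩ).const_mul κ
  have i8 : IntegrableOn (fun _ : EuclideanSpace ℝ (Fin n) => C) Ω :=
    (BC.of_cont hΩ continuous_const).int hΩ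
  have hm : ∫ x in Ω, (ρ * (Θ (u x) * V x) + Ψ (V x) * f (u x)) ≤
      ∫ x in Ω, (ρ * (√(deriv f (u x)) * θ (u x) ^ 2) + (1 - ε) * (√(deriv f (u x)) * ψ (V x) ^ 2)
        + ε * c * ψ (V x) ^ 2 - κ * f (u x) ^ p - κ * V x + C) := by
    apply setIntegral_mono_on (i1.add i2) (((((i3.add i4).add i5).sub i6).sub i7).add i8)
      hΩ.1.measurableSet
    intro x hx
    exact hkey _ (h.upos x hx) _ (h.Vpos x hx)
  have k1 := i3.fun_add i4
  have k2 := k1.fun_add i5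
  have k3 := int_fsub k2 i6
  have k4 := int_fsub k3 i7
  rw [integral_add i1 i2, integral_add k4 i8, integral_sub k3 i7, integral_sub k2 i6,
    integral_add k1 i5, integral_add i3 i4] at hm
  simp only [integral_const_mul, setIntegral_const, smul_eq_mul] at hm
  have j1 := mul_le_mul_of_nonneg_left I hρ.le
  have j2 := mul_le_mul_of_nonneg_left II (by linarith : 0 ≤ 1 - ε)
  have j3 := mul_le_mul_of_nonneg_left III hε.le
  linarith

end SolPart


section HeatPart
variable {n : ℕ}

/-- Gaussian with parameter `b`. -/
def gb (b : ℝ) (z : EuclideanSpace ℝ (Fin n)) : ℝ := rexp (-b * ‖z‖ ^ 2)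

lemma gb_pos (b : ℝ) (z : EuclideanSpace ℝ (Fin n)) : 0 < gb b z := Real.exp_pos _

lemma gb_le {b : ℝ} (hb : 0 < b) (z : EuclideanSpace ℝ (Fin n)) : gb b z ≤ 1 := by
  unfold gb
  rw [Real.exp_le_one_iff]
  have : 0 ≤ b * ‖z‖ ^ 2 := by positivity
  linarith

lemma gb_int_pos {b : ℝ} (hb : 0 < b) : 0 < ∫ z : EuclideanSpace ℝ (Fin n), gb b z := by
  unfold gb
  rw [GaussianFourier.integral_rexp_neg_mul_sq_norm hb]
  positivity

lemma gb_int {b : ℝ} (hb : 0 < b) : Integrable (fun z : EuclideanSpace ℝ (Fin n) => gb b z) := by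
  by_contra h
  have := gb_int_pos (n := n) hb
  rw [integral_undef h] at this
  exact lt_irrefl _ this

lemma gb_cd (b : ℝ) : ContDiff ℝ (⊤ : ℕ∞) (fun z : EuclideanSpace ℝ (Fin n) => gb b z) := by
  unfold gb
  exact Real.contDiff_exp.comp (contDiff_const.mul (contDiff_norm_sq ℝ))

lemma pd_gb (i : Fin n) (z : EuclideanSpace ℝ (Fin n)) :
    pd i (gb (1/2)) z = - (z i * gb (1/2) z) := by
  have hw : ContDiff ℝ (⊤ : ℕ∞) (fun z : EuclideanSpace ℝ (Fin n) => ‖z‖ ^ 2) := contDiff_norm_sq ℝ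
  have hG : ContDiff ℝ (⊤ : ℕ∞) (fun t : ℝ => rexp (-(1/2) * t)) :=
    Real.contDiff_exp.comp (contDiff_const.mul contDiff_id)
  have h1 := pd_comp hw hG i z
  have e : (gb (1/2) : EuclideanSpace ℝ (Fin n) → ℝ) = fun y => (fun t : ℝ => rexp (-(1/2) * t)) (‖y‖ ^ 2) := rfl
  rw [e, h1]
  have h2 : pd i (fun z : EuclideanSpace ℝ (Fin n) => ‖z‖ ^ 2) z = 2 * z i := by
    unfold pd
    rw [fderiv_norm_sq_apply]
    simp [EuclideanSpace.inner_single_right]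
  have h3 : HasDerivAt (fun t : ℝ => rexp (-(1/2) * t)) (rexp (-(1/2) * ‖z‖^2) * (-(1/2))) (‖z‖^2) := by
    have := ((hasDerivAt_id (‖z‖^2)).const_mul (-(1/2) : ℝ)).exp
    simpa using this
  rw [h2, h3.deriv]
  simp only
  ring

lemma norm_gb (z : EuclideanSpace ℝ (Fin n)) : ‖z‖ * gb (1/2) z ≤ gb (1/4) z := by
  have h1 : ‖z‖ ≤ rexp (1/4 * ‖z‖^2) := by
    have := Real.add_one_le_exp (1/4 * ‖z‖^2)
    nlinarith [sq_nonneg (‖z‖ / 2 - 1)]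
  have h2 : gb (1/4) z = rexp (1/4 * ‖z‖^2) * gb (1/2) z := by
    unfold gb
    rw [← Real.exp_add]; ring_nf
  rw [h2]
  exact mul_le_mul_of_nonneg_right h1 (gb_pos _ _).le

lemma int_bdd_gb {b : ℝ} (hb : 0 < b) {g : EuclideanSpace ℝ (Fin n) → ℝ}
    (hg : AEStronglyMeasurable g) {B : ℝ} (hB : ∀ z, |g z| ≤ B) :
    Integrable (fun z => g z * gb b z) :=
  (gb_int hb).bdd_mul hg (Eventually.of_forall hB)

lemma int_bdd_gb' {g : EuclideanSpace ℝ (Fin n) → ℝ}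
    (hg : Continuous g) {B : ℝ} (hB : ∀ z, |g z| ≤ B) (i : Fin n) :
    Integrable (fun z => g z * (z i * gb (1/2) z)) := by
  have h1 : Integrable (fun z : EuclideanSpace ℝ (Fin n) => z i * gb (1/2) z) := by
    refine (gb_int (b := 1/4) (by norm_num)).mono' ?_ (Eventually.of_forall fun z => ?_)
    · have := (gb_cd (n := n) (1/2)).continuous
      exact (Continuous.mul (by fun_prop) this).aestronglyMeasurable
    · rw [norm_mul]
      have h3 : ‖z i‖ ≤ ‖z‖ := PiLp.norm_apply_le z i
      rw [Real.norm_of_nonneg (gb_pos _ z).le]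
      exact (mul_le_mul_of_nonneg_right h3 (gb_pos _ z).le).trans (norm_gb z)
  exact h1.bdd_mul hg.aestronglyMeasurable (Eventually.of_forall hB)

lemma aff_cd {W : EuclideanSpace ℝ (Fin n) → ℝ} (hW : ContDiff ℝ (⊤ : ℕ∞) W)
    (x0 : EuclideanSpace ℝ (Fin n)) (s : ℝ) :
    ContDiff ℝ (⊤ : ℕ∞) (fun z => W (x0 + s • z)) := by
  have h : ContDiff ℝ (⊤ : ℕ∞) (fun z : EuclideanSpace ℝ (Fin n) => x0 + s • z) := by fun_prop
  exact hW.comp h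

lemma pd_aff {W : EuclideanSpace ℝ (Fin n) → ℝ} (hW : ContDiff ℝ (⊤ : ℕ∞) W)
    (x0 : EuclideanSpace ℝ (Fin n)) (s : ℝ) (i : Fin n) (z : EuclideanSpace ℝ (Fin n)) :
    pd i (fun z => W (x0 + s • z)) z = s * pd i W (x0 + s • z) := by
  unfold pd
  have h1 : HasFDerivAt (fun z : EuclideanSpace ℝ (Fin n) => x0 + s • z)
      (s • ContinuousLinearMap.id ℝ (EuclideanSpace ℝ (Fin n))) z :=
    ((hasFDerivAt_id z).const_smul s).const_add x0
  have h2 := (cd_diff hW (x0 + s • z)).hasFDerivAt.comp z h1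
  have e : (fun z => W (x0 + s • z)) = W ∘ (fun z => x0 + s • z) := rfl
  rw [e, h2.fderiv]
  simp

lemma vec_sum (z : EuclideanSpace ℝ (Fin n)) :
    z = ∑ i, z i • (EuclideanSpace.single i (1:ℝ) : EuclideanSpace ℝ (Fin n)) := by
  ext j
  simp [Pi.single_apply]

lemma cs_bdd {E F : Type*} [TopologicalSpace E] [NormedAddCommGroup F] {W : E → F}
    (hW : Continuous W) (hc : HasCompactSupport W) : ∃ B : ℝ, 0 ≤ B ∧ ∀ x, ‖W x‖ ≤ B := by
  obtain ⟨B, hB⟩ := hc.exists_bound_of_continuous hW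
  exact ⟨|B|, abs_nonneg _, fun x => (hB x).trans (le_abs_self _)⟩

lemma heat_deriv {W : EuclideanSpace ℝ (Fin n) → ℝ} (hW : ContDiff ℝ (⊤ : ℕ∞) W)
    (hc : HasCompactSupport W) (x0 : EuclideanSpace ℝ (Fin n)) (s : ℝ) :
    HasDerivAt (fun s : ℝ => ∫ z, W (x0 + s • z) * gb (1/2) z)
      (s * ∫ z, lap W (x0 + s • z) * gb (1/2) z) s := by
  have gc := (gb_cd (n := n) (1/2)).continuous
  obtain ⟨B0, hB0, hb0⟩ := cs_bdd hW.continuous hc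
  have hfc : Continuous (fderiv ℝ W) := hW.continuous_fderiv (by simp)
  obtain ⟨B1, hB1, hb1⟩ := cs_bdd hfc (hc.fderiv ℝ)
  have haff : ∀ s : ℝ, Continuous (fun z : EuclideanSpace ℝ (Fin n) => x0 + s • z) :=
    fun s => by fun_prop
  have main := hasDerivAt_integral_of_dominated_loc_of_deriv_le (μ := volume) (s := univ) (x₀ := s)
    (F := fun s z => W (x0 + s • z) * gb (1/2) z)
    (F' := fun s z => fderiv ℝ W (x0 + s • z) z * gb (1/2) z)
    (bound := fun z => B1 * gb (1/4) z) univ_mem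
    (Eventually.of_forall fun s =>
      ((hW.continuous.comp (haff s)).mul gc).aestronglyMeasurable)
    (int_bdd_gb (by norm_num) (hW.continuous.comp (haff s)).aestronglyMeasurable (fun z => hb0 _))
    ((((hfc.comp (haff s)).clm_apply continuous_id).mul gc).aestronglyMeasurable)
    (Eventually.of_forall fun z r _ => by
      rw [norm_mul, Real.norm_of_nonneg (gb_pos _ z).le]
      have h1 : ‖fderiv ℝ W (x0 + r • z) z‖ ≤ B1 * ‖z‖ :=
        (ContinuousLinearMap.le_opNorm _ _).trans
          (mul_le_mul_of_nonneg_right (hb1 _) (norm_nonneg _))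
      calc _ ≤ B1 * ‖z‖ * gb (1/2) z := mul_le_mul_of_nonneg_right h1 (gb_pos _ z).le
        _ = B1 * (‖z‖ * gb (1/2) z) := by ring
        _ ≤ _ := mul_le_mul_of_nonneg_left (norm_gb z) hB1)
    ((gb_int (by norm_num)).const_mul _)
    (Eventually.of_forall fun z r _ => by
      have h1 : HasDerivAt (fun t : ℝ => x0 + t • z) z r := by
        simpa using ((hasDerivAt_id r).smul_const z).const_add x0
      exact ((cd_diff hW _).hasFDerivAt.comp_hasDerivAt r h1).mul_const _)
  refine main.2.congr_deriv ?_
  have e1 : ∀ z : EuclideanSpace ℝ (Fin n), fderiv ℝ W (x0 + s • z) z * gb (1/2) z =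
      ∑ i, pd i W (x0 + s • z) * (z i * gb (1/2) z) := by
    intro z
    have : fderiv ℝ W (x0 + s • z) z = ∑ i, z i * pd i W (x0 + s • z) := by
      conv_lhs => rw [vec_sum z]
      rw [map_sum]
      refine Finset.sum_congr rfl fun i _ => ?_
      rw [map_smul, smul_eq_mul, ← vec_sum z]; rfl
    rw [this, Finset.sum_mul]
    exact Finset.sum_congr rfl fun i _ => by ring
  have e2 : ∀ z : EuclideanSpace ℝ (Fin n), lap W (x0 + s • z) * gb (1/2) z =
      ∑ i, pd i (pd i W) (x0 + s • z) * gb (1/2) z := by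
    intro z; rw [lap_eq hW, Finset.sum_mul]
  have cpd : ∀ i, HasCompactSupport (pd i W) := fun i => hc.fderiv_apply ℝ _
  have cpd2 : ∀ i, HasCompactSupport (pd i (pd i W)) := fun i => (cpd i).fderiv_apply ℝ _
  have J1 : ∀ i, Integrable (fun z : EuclideanSpace ℝ (Fin n) =>
      pd i W (x0 + s • z) * (z i * gb (1/2) z)) := by
    intro i
    obtain ⟨B, _, hB⟩ := cs_bdd (pd_cd hW i).continuous (cpd i)
    exact int_bdd_gb' ((pd_cd hW i).continuous.comp (haff s)) (fun z => hB _) i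
  have J2 : ∀ i, Integrable (fun z : EuclideanSpace ℝ (Fin n) =>
      pd i (pd i W) (x0 + s • z) * gb (1/2) z) := by
    intro i
    obtain ⟨B, _, hB⟩ := cs_bdd (pd_cd (pd_cd hW i) i).continuous (cpd2 i)
    exact int_bdd_gb (by norm_num)
      ((pd_cd (pd_cd hW i) i).continuous.comp (haff s)).aestronglyMeasurable (fun z => hB _)
  have J3 : ∀ i, Integrable (fun z : EuclideanSpace ℝ (Fin n) =>
      pd i W (x0 + s • z) * gb (1/2) z) := by
    intro i
    obtain ⟨B, _, hB⟩ := cs_bdd (pd_cd hW i).continuous (cpd i)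
    exact int_bdd_gb (by norm_num)
      ((pd_cd hW i).continuous.comp (haff s)).aestronglyMeasurable (fun z => hB _)
  simp_rw [e1, e2]
  rw [integral_finsetSum _ (fun i _ => J1 i), integral_finsetSum _ (fun i _ => J2 i), Finset.mul_sum]
  refine Finset.sum_congr rfl fun i _ => ?_
  have ibp := integral_mul_fderiv_eq_neg_fderiv_mul_of_integrable (μ := volume)
    (f := fun z : EuclideanSpace ℝ (Fin n) => pd i W (x0 + s • z)) (g := gb (1/2))
    (v := EuclideanSpace.single i (1:ℝ))
    (by
      have := (J2 i).const_mul s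
      refine this.congr (Eventually.of_forall fun z => ?_)
      have h := pd_aff (pd_cd hW i) x0 s i z
      unfold pd at h ⊢
      simp only
      rw [h]; ring)
    (by
      have := (J1 i).neg
      refine this.congr (Eventually.of_forall fun z => ?_)
      have h := pd_gb i z
      rw [pd] at h
      simp only [Pi.neg_apply]
      rw [h]; ring)
    (J3 i) (fun z _ => cd_diff (aff_cd (pd_cd hW i) x0 s) z) (fun z _ => cd_diff (gb_cd _) z)
  have e3 : ∀ z, fderiv ℝ (gb (1/2)) z (EuclideanSpace.single i (1:ℝ)) = - (z i * gb (1/2) z) :=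
    fun z => pd_gb i z
  have e4 : ∀ z, fderiv ℝ (fun z : EuclideanSpace ℝ (Fin n) => pd i W (x0 + s • z)) z
      (EuclideanSpace.single i (1:ℝ)) = s * pd i (pd i W) (x0 + s • z) :=
    fun z => pd_aff (pd_cd hW i) x0 s i z
  simp_rw [e3, e4, mul_neg, mul_assoc] at ibp
  rw [integral_neg, integral_const_mul] at ibp
  exact neg_injective ibp

lemma exists_G : ∃ G : ℝ → ℝ, ContDiff ℝ (⊤ : ℕ∞) G ∧ (∀ t ≤ 1, G t = 0) ∧
    (∀ t, 0 ≤ deriv G t ∧ deriv G t ≤ 1) ∧ (∀ t, 0 ≤ deriv (deriv G) t) ∧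
    (∀ t ≥ 0, t - 2 ≤ G t) ∧ (∀ t ≥ 0, 0 ≤ G t ∧ G t ≤ t) := by
  set g : ℝ → ℝ := fun t => smoothTransition (t - 1) with hg
  have hgc : ContDiff ℝ (⊤ : ℕ∞) g := smoothTransition.contDiff.comp (contDiff_id.sub contDiff_const)
  have hgm : Monotone g := fun a b h => smoothTransition.monotone (by linarith)
  set G : ℝ → ℝ := fun t => ∫ s in (0:ℝ)..t, g s with hG
  have hd : ∀ t, HasDerivAt G (g t) t := fun t =>
    (hgc.continuous.integral_hasStrictDerivAt 0 t).hasDerivAt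
  have hdG : deriv G = g := funext fun t => (hd t).deriv
  have hm : Monotone G := monotone_of_hasDerivAt_nonneg hd (fun t => smoothTransition.nonneg _)
  have h0 : G 0 = 0 := by simp [hG]
  have hz : ∀ t ≤ 1, G t = 0 := by
    intro t ht
    simp only [hG]
    apply intervalIntegral.integral_zero_ae
    refine Eventually.of_forall fun s hs => ?_
    have h2 := hs.2
    have hs' : s ≤ 1 := by
      rcases le_total 0 t with h | h
      · rw [max_eq_right h] at h2; linarith
      · rw [max_eq_left h] at h2; linarith
    simp only [hg]
    exact smoothTransition.zero_of_nonpos (by linarith)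
  have hm2 : Monotone (fun t => t - G t) :=
    monotone_of_hasDerivAt_nonneg (fun t => (hasDerivAt_id t).sub (hd t))
      (fun t => by have := smoothTransition.le_one (t - 1); simp only [hg, Pi.zero_apply]; linarith)
  refine ⟨G, ?_, hz, ?_, ?_, ?_, ?_⟩
  · rw [contDiff_infty_iff_deriv]
    exact ⟨fun t => (hd t).differentiableAt, by rw [hdG]; exact hgc⟩
  · intro t
    rw [hdG]
    exact ⟨smoothTransition.nonneg _, smoothTransition.le_one _⟩
  · intro t
    rw [hdG]
    exact hgm.deriv_nonneg
  · intro t ht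
    rcases le_total t 2 with h | h
    · have := hm ht
      rw [h0] at this
      linarith
    · have hmo : MonotoneOn (fun t => G t - t) (Ici 2) := by
        have hd' : ∀ s, HasDerivAt (fun t => G t - t) (g s - 1) s := fun s => (hd s).sub (hasDerivAt_id s)
        apply monotoneOn_of_hasDerivWithinAt_nonneg (convex_Ici _)
          (fun s hs => (hd' s).continuousAt.continuousWithinAt)
          (fun s hs => (hd' s).hasDerivWithinAt)
        intro s hs
        have hs : 2 ≤ s := interior_subset hs
        simp only [hg]
        rw [smoothTransition.one_of_one_le (by linarith)]; simp
      have h1 := hmo self_mem_Ici h h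
      have h2 := hm (show (0:ℝ) ≤ 2 by norm_num)
      rw [h0] at h2
      simp only at h1
      linarith
  · intro t ht
    have h1 := hm ht
    have h2 := hm2 ht
    simp only at h2
    rw [h0] at h1 h2
    exact ⟨h1, by linarith⟩

end HeatPart


section SupPart
variable {n : ℕ} {Ω : Set (EuclideanSpace ℝ (Fin n))}

/-- Gaussian average at scale `s`. -/
def avg (W : EuclideanSpace ℝ (Fin n) → ℝ) (x0 : EuclideanSpace ℝ (Fin n)) (s : ℝ) : ℝ :=
  ∫ z, W (x0 + s • z) * gb (1/2) z

lemma ode_bound {m A m' A' : ℝ → ℝ} {L D γ T k : ℝ} (hL : 0 ≤ L) (hD : 0 ≤ D) (h2 : 2 < γ)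
    (h4 : γ < 4) (hT : 0 < T)
    (hm : ∀ s, HasDerivAt m (m' s) s) (hA : ∀ s, HasDerivAt A (A' s) s)
    (hm' : ∀ s, 0 < s → s ≤ T → -(D * s ^ (1 - γ)) ≤ m' s)
    (hA' : ∀ s, 0 < s → s ≤ T → -(s * (L * (k + m s))) ≤ A' s) :
    A 0 ≤ A T + L * (k + m T) * T ^ 2 / 2 + L * D / ((γ - 2) * (4 - γ)) * T ^ (4 - γ) := by
  have g2 : 0 < γ - 2 := by linarith
  have g4 : 0 < 4 - γ := by linarith
  have step1 : ∀ s, 0 < s → s ≤ T → m s ≤ m T + D / (γ - 2) * s ^ (2 - γ) := by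
    intro s hs hsT
    have hd : ∀ t, 0 < t → HasDerivAt (fun t => m t - D / (γ - 2) * t ^ (2 - γ))
        (m' t + D * t ^ (1 - γ)) t := by
      intro t ht
      have := (hm t).sub ((Real.hasDerivAt_rpow_const (p := 2 - γ) (Or.inl ht.ne')).const_mul (D / (γ - 2)))
      refine this.congr_deriv ?_
      rw [show 2 - γ - 1 = 1 - γ by ring]
      field_simp
      ring
    have hmo : MonotoneOn (fun t => m t - D / (γ - 2) * t ^ (2 - γ)) (Icc s T) := by
      apply monotoneOn_of_hasDerivWithinAt_nonneg (convex_Icc _ _)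
        (fun t ht => (hd t (hs.trans_le ht.1)).continuousAt.continuousWithinAt)
        (fun t ht => (hd t (hs.trans_le (interior_subset ht).1)).hasDerivWithinAt)
      intro t ht
      have ht := interior_subset ht
      have := hm' t (hs.trans_le ht.1) ht.2
      linarith
    have h := hmo (left_mem_Icc.2 hsT) (right_mem_Icc.2 hsT) hsT
    simp only at h
    have h' : 0 ≤ D / (γ - 2) * T ^ (2 - γ) := by positivity
    linarith
  have hd : ∀ t, 0 < t → HasDerivAt (fun t => A t + L * (k + m T) * t ^ 2 / 2 +
      L * D / ((γ - 2) * (4 - γ)) * t ^ (4 - γ))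
      (A' t + L * (k + m T) * t + L * D / (γ - 2) * t ^ (3 - γ)) t := by
    intro t ht
    have e1 := ((hasDerivAt_pow 2 t).const_mul (L * (k + m T))).div_const 2
    have e2 := (Real.hasDerivAt_rpow_const (p := 4 - γ) (Or.inl ht.ne')).const_mul
      (L * D / ((γ - 2) * (4 - γ)))
    refine (((hA t).add e1).add e2).congr_deriv ?_
    rw [show 4 - γ - 1 = 3 - γ by ring]
    field_simp
    ring
  have hmo : MonotoneOn (fun t => A t + L * (k + m T) * t ^ 2 / 2 +
      L * D / ((γ - 2) * (4 - γ)) * t ^ (4 - γ)) (Icc 0 T) := by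
    have hcA : Continuous A := continuous_iff_continuousAt.2 fun s => (hA s).continuousAt
    have hcr : Continuous (fun t : ℝ => t ^ (4 - γ)) := Real.continuous_rpow_const g4.le
    refine monotoneOn_of_hasDerivWithinAt_nonneg (convex_Icc _ _)
      (Continuous.continuousOn (by fun_prop))
      (f' := fun t => A' t + L * (k + m T) * t + L * D / (γ - 2) * t ^ (3 - γ))
      (fun t ht => ?_) (fun t ht => ?_)
    · rw [interior_Icc] at ht
      exact (hd t ht.1).hasDerivWithinAt
    · rw [interior_Icc] at ht
      have h1 := hA' t ht.1 ht.2.le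
      have h3 := step1 t ht.1 ht.2.le
      have e : t ^ (3 - γ) = t * t ^ (2 - γ) := by
        rw [show 3 - γ = 1 + (2 - γ) by ring, Real.rpow_add ht.1, Real.rpow_one]
      rw [e]
      have h5 : t * L * m t ≤ t * L * (m T + D / (γ - 2) * t ^ (2 - γ)) :=
        mul_le_mul_of_nonneg_left h3 (mul_nonneg ht.1.le hL)
      have e6 : L * D / (γ - 2) * (t * t ^ (2 - γ)) = t * L * (D / (γ - 2) * t ^ (2 - γ)) := by ring
      rw [e6]
      nlinarith
  have h := hmo (left_mem_Icc.2 hT.le) (right_mem_Icc.2 hT.le) hT.le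
  simp only at h
  rw [Real.zero_rpow g4.ne'] at h
  simpa using h

lemma lap_ext_ge (hΩ : GoodDomain Ω) {G : ℝ → ℝ} (hGc : ContDiff ℝ (⊤ : ℕ∞) G)
    (hz : ∀ t ≤ 1, G t = 0)
    (hG1 : ∀ t, 0 ≤ deriv G t ∧ deriv G t ≤ 1) (hG2 : ∀ t, 0 ≤ deriv (deriv G) t)
    {w g : EuclideanSpace ℝ (Fin n) → ℝ} (hw : ContDiff ℝ (⊤ : ℕ∞) w)
    (hb : ∀ x ∈ frontier Ω, w x = 0) {L : ℝ} (hL : 0 ≤ L) (hg : ∀ x ∈ Ω, 0 ≤ g x)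
    (hl : ∀ x ∈ Ω, lap w x = -(L * g x)) (x : EuclideanSpace ℝ (Fin n)) :
    -(L * Ω.indicator g x) ≤ lap (ext0 Ω G w) x := by
  have hs : tsupport (ext0 Ω G w) ⊆ Ω := ext0_supp hΩ one_pos hw.continuous hb hz
  by_cases hx : x ∈ Ω
  · rw [lap_congr (ext0_nhds hΩ.1 hx), lap_comp hw hGc, hl x hx, indicator_of_mem hx]
    have h1 : 0 ≤ deriv (deriv G) (w x) * ∑ i, (pd i w x) ^ 2 :=
      mul_nonneg (hG2 _) (Finset.sum_nonneg fun i _ => sq_nonneg _)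
    have h2 := hG1 (w x)
    have h3 : 0 ≤ L * g x := mul_nonneg hL (hg x hx)
    nlinarith
  · rw [lap_out (ext0_cd hΩ hw hGc hs) hs hx, indicator_of_notMem hx]
    simp

lemma aff_int {F : EuclideanSpace ℝ (Fin n) → ℝ} (hF : Integrable F)
    (x0 : EuclideanSpace ℝ (Fin n)) {s : ℝ} (hs : 0 < s) :
    Integrable (fun z => F (x0 + s • z)) := by
  have h1 : Integrable (fun z => F (x0 + z)) := hF.comp_add_left x0
  exact h1.comp_smul hs.ne'

lemma avg_scal {F : EuclideanSpace ℝ (Fin n) → ℝ} (hF : Integrable F) (h0 : ∀ x, 0 ≤ F x)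
    (x0 : EuclideanSpace ℝ (Fin n)) {s : ℝ} (hs : 0 < s) :
    avg F x0 s ≤ (s ^ n)⁻¹ * ∫ x, F x := by
  have h1 : ∫ z, F (x0 + s • z) = (s ^ n)⁻¹ * ∫ x, F x := by
    have h := Measure.integral_comp_smul (volume : Measure (EuclideanSpace ℝ (Fin n)))
      (fun z => F (x0 + z)) s
    rw [integral_add_left_eq_self F x0, finrank_euclideanSpace_fin, abs_of_pos (by positivity),
      smul_eq_mul] at h
    exact h
  rw [← h1]
  refine integral_mono_of_nonneg (Eventually.of_forall fun z => ?_) (aff_int hF x0 hs)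
    (Eventually.of_forall fun z => ?_)
  · exact mul_nonneg (h0 _) (gb_pos _ z).le
  · have := mul_le_mul_of_nonneg_left (gb_le (b := 1/2) (by norm_num) z) (h0 (x0 + s • z))
    simpa using this

/-- bounded and integrable -/
def BI (F : EuclideanSpace ℝ (Fin n) → ℝ) : Prop := Integrable F ∧ ∃ B, ∀ x, |F x| ≤ B

lemma BC.ind (hΩ : GoodDomain Ω) {g : EuclideanSpace ℝ (Fin n) → ℝ} (h : BC Ω g) :
    BI (Ω.indicator g) := by
  refine ⟨(h.int hΩ).integrable_indicator hΩ.1.measurableSet, ?_⟩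
  obtain ⟨_, B, hB⟩ := h
  refine ⟨|B|, fun x => ?_⟩
  by_cases hx : x ∈ Ω
  · rw [indicator_of_mem hx]; exact (hB x hx).trans (le_abs_self _)
  · rw [indicator_of_notMem hx]; simp

lemma cs_BI {W : EuclideanSpace ℝ (Fin n) → ℝ} (hW : Continuous W) (hc : HasCompactSupport W) :
    BI W := by
  obtain ⟨B, _, hB⟩ := cs_bdd hW hc
  exact ⟨hW.integrable_of_hasCompactSupport hc, B, hB⟩

lemma BI.avg_int {F : EuclideanSpace ℝ (Fin n) → ℝ} (h : BI F)
    (x0 : EuclideanSpace ℝ (Fin n)) {s : ℝ} (hs : 0 < s) :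
    Integrable (fun z => F (x0 + s • z) * gb (1/2) z) := by
  obtain ⟨h1, B, hB⟩ := h
  exact int_bdd_gb (by norm_num) (aff_int h1 x0 hs).aestronglyMeasurable (fun z => hB _)

lemma avg_affine {F H : EuclideanSpace ℝ (Fin n) → ℝ} (hF : BI F) (hH : BI H) {a b : ℝ}
    (h : ∀ x, F x ≤ a + b * H x) (x0 : EuclideanSpace ℝ (Fin n)) {s : ℝ} (hs : 0 < s) :
    avg F x0 s ≤ a * (∫ z : EuclideanSpace ℝ (Fin n), gb (1/2) z) + b * avg H x0 s := by
  have i1 := (gb_int (n := n) (b := 1/2) (by norm_num)).const_mul a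
  have i2 := (hH.avg_int x0 hs).const_mul b
  unfold avg
  rw [← integral_const_mul, ← integral_const_mul, ← integral_add i1 i2]
  refine integral_mono (hF.avg_int x0 hs) (i1.add i2) fun z => ?_
  have := mul_le_mul_of_nonneg_right (h (x0 + s • z)) (gb_pos (1/2) z).le
  simp only
  linarith

lemma avg_lower {F W : EuclideanSpace ℝ (Fin n) → ℝ} (hF : BI F) (hW : BI W) {L : ℝ}
    (h : ∀ x, -(L * F x) ≤ W x) (x0 : EuclideanSpace ℝ (Fin n)) {s : ℝ} (hs : 0 < s) :
    -(L * avg F x0 s) ≤ avg W x0 s := by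
  have i2 := (hF.avg_int x0 hs).const_mul (-L)
  unfold avg
  rw [← neg_mul, ← integral_const_mul]
  refine integral_mono i2 (hW.avg_int x0 hs) fun z => ?_
  have := mul_le_mul_of_nonneg_right (h (x0 + s • z)) (gb_pos (1/2) z).le
  simp only
  linarith

lemma rpow_young {σ p μ y : ℝ} (hσ : 0 < σ) (hσp : σ < p) (hμ : 0 < μ) (hy : 0 ≤ y) :
    y ^ σ ≤ μ + μ ^ (1 - p / σ) * y ^ p := by
  rcases le_total (y ^ σ) μ with h | h
  · have : 0 ≤ μ ^ (1 - p / σ) * y ^ p := by positivity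
    linarith
  · have hq : 0 ≤ p / σ - 1 := by
      rw [sub_nonneg, le_div_iff₀ hσ]; linarith
    have hY : 0 < y ^ σ := hμ.trans_le h
    have h1 : μ ^ (p / σ - 1) ≤ (y ^ σ) ^ (p / σ - 1) := Real.rpow_le_rpow hμ.le h hq
    have h2 : y ^ p = y ^ σ * (y ^ σ) ^ (p / σ - 1) := by
      have : (y ^ σ) ^ (p / σ) = y ^ p := by
        rw [← Real.rpow_mul hy]; congr 1; field_simp
      rw [← this, ← Real.rpow_one_add' hY.le (by intro h0; have : p / σ = 0 := by linarith
                                                 have : 0 < p / σ := div_pos (hσ.trans hσp) hσ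
                                                 linarith)]
      congr 1; ring
    have h3 : μ ^ (1 - p / σ) * μ ^ (p / σ - 1) = 1 := by
      rw [← Real.rpow_add hμ]; simp
    rw [h2]
    have h4 : y ^ σ * 1 ≤ y ^ σ * (μ ^ (1 - p / σ) * (y ^ σ) ^ (p / σ - 1)) := by
      apply mul_le_mul_of_nonneg_left _ hY.le
      have h5 := mul_le_mul_of_nonneg_left h1 (show 0 ≤ μ ^ (1 - p / σ) by positivity)
      linarith
    nlinarith

lemma sup_bound {f : ℝ → ℝ} (hf : HypH ⊤ f) (hΩ : GoodDomain Ω) {σ p Cσ : ℝ} (hσ : 0 < σ)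
    (hσp : σ < p) (hC : 0 < Cσ) (hfs : ∀ t > 0, f t ≤ Cσ * (1 + t) * f t ^ σ)
    (hn : (n : ℝ) * σ < 4 * p) {Λ K1 K2 K3 : ℝ} (hΛ : 0 < Λ) (hK1 : 0 ≤ K1) :
    ∃ B : ℝ, ∀ L u V, SolP Ω f L u V → L ≤ Λ → (∫ x in Ω, f (u x) ^ p) ≤ K1 →
      (∫ x in Ω, V x) ≤ K2 → (∫ x in Ω, u x) ≤ K3 → ∀ x ∈ Ω, u x ≤ B := by
  obtain ⟨G, hGc, hz, hG1, hG2, hGl, hGu⟩ := exists_G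
  have hp : 0 < p := hσ.trans hσp
  obtain ⟨γ, hγ1, hγ4⟩ := exists_between (show max ((n:ℝ) * σ / p) 2 < 4 from
    max_lt (by rw [div_lt_iff₀ hp]; exact hn) (by norm_num))
  have hγn : (n:ℝ) * σ / p < γ := (le_max_left _ _).trans_lt hγ1
  have hγ2 : 2 < γ := (le_max_right _ _).trans_lt hγ1
  have g2 : 0 < γ - 2 := by linarith
  have g4 : 0 < 4 - γ := by linarith
  set c0 := ∫ z : EuclideanSpace ℝ (Fin n), gb (1/2) z with hc0
  have c0p : 0 < c0 := gb_int_pos (by norm_num)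
  set C1 := Cσ * (c0 + K1) with hC1
  have C1p : 0 < C1 := by positivity
  set H := Λ * (Λ * C1) / ((γ - 2) * (4 - γ)) with hH
  have Hp : 0 < H := by positivity
  obtain ⟨T, hT0, hT1, hTH⟩ : ∃ T : ℝ, 0 < T ∧ T ≤ 1 ∧ H * T ^ (4 - γ) ≤ c0 / 2 := by
    have h1 : Tendsto (fun t : ℝ => H * t ^ (4 - γ)) (𝓝[>] 0) (𝓝 (H * 0 ^ (4 - γ))) :=
      ((Real.continuousAt_rpow_const 0 (4 - γ) (Or.inr g4.le)).tendsto.const_mul H).mono_left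
        nhdsWithin_le_nhds
    rw [Real.zero_rpow g4.ne', mul_zero] at h1
    have h2 := h1.eventually_le_const (show (0:ℝ) < c0 / 2 by positivity)
    have h3 : ∀ᶠ t : ℝ in 𝓝[>] 0, t ∈ Ioc (0:ℝ) 1 := Ioc_mem_nhdsGT one_pos
    obtain ⟨t, ht1, ht2⟩ := (h2.and h3).exists
    exact ⟨t, ht2.1, ht2.2, ht1⟩
  refine ⟨(|(T ^ n)⁻¹ * K3| + Λ * (2 * c0 + |(T ^ n)⁻¹ * K2|) + c0 / 2 + 2 * c0) * (2 / c0), ?_⟩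
  intro L u V h hL hI1 hI2 hI3
  -- the maximum
  obtain ⟨x0, hx0c, hx0⟩ := hΩ.2.1.isCompact_closure.exists_isMaxOn
    (hΩ.2.2.mono subset_closure) h.ucd.continuous.continuousOn
  have hx0Ω : x0 ∈ Ω := by
    by_contra hcon
    have hfr : x0 ∈ frontier Ω := by
      rw [hΩ.1.frontier_eq]; exact ⟨hx0c, hcon⟩
    obtain ⟨y, hy⟩ := hΩ.2.2
    have h1 : u y ≤ u x0 := hx0 (subset_closure hy)
    have h2 := h.ub x0 hfr
    have h3 := h.upos y hy
    linarith
  have hmax : ∀ x ∈ Ω, u x ≤ u x0 := fun x hx => hx0 (subset_closure hx)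
  set M := u x0 with hM
  have hMp : 0 < M := h.upos x0 hx0Ω
  have hLp := h.Lpos
  suffices hMB : M ≤ (|(T ^ n)⁻¹ * K3| + Λ * (2 * c0 + |(T ^ n)⁻¹ * K2|) + c0 / 2 + 2 * c0) * (2 / c0) from
    fun x hx => (hmax x hx).trans hMB
  have sU : tsupport (ext0 Ω G u) ⊆ Ω := ext0_supp hΩ one_pos h.ucd.continuous h.ub hz
  have sV : tsupport (ext0 Ω G V) ⊆ Ω := ext0_supp hΩ one_pos h.Vcd.continuous h.Vb hz
  have cU := ext0_cd hΩ h.ucd hGc sU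
  have cV := ext0_cd hΩ h.Vcd hGc sV
  have kU := ext0_compact hΩ sU
  have kV := ext0_compact hΩ sV
  have bf := (bc_f hf hΩ h).ind hΩ
  have bfp := (bc_fp hf hΩ hp.le h).ind hΩ
  have bV := (BC.of_cont hΩ h.Vcd.continuous).ind hΩ
  have bu := (BC.of_cont hΩ h.ucd.continuous).ind hΩ
  have bVe := cs_BI cV.continuous kV
  have bUe := cs_BI cU.continuous kU
  have lapBI : ∀ {W : EuclideanSpace ℝ (Fin n) → ℝ}, ContDiff ℝ (⊤ : ℕ∞) W → HasCompactSupport W →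
      BI (lap W) := by
    intro W hW hc
    refine cs_BI (lap_cd hW).continuous ?_
    refine HasCompactSupport.of_support_subset_isCompact hc.isCompact ?_
    intro x hx
    by_contra hcon
    exact hx (lap_out hW subset_rfl hcon)
  have ext_nonneg : ∀ w : EuclideanSpace ℝ (Fin n) → ℝ, (∀ x ∈ Ω, 0 < w x) →
      ∀ x, 0 ≤ ext0 Ω G w x ∧ ext0 Ω G w x ≤ Ω.indicator w x ∧
        Ω.indicator w x ≤ 2 + 1 * ext0 Ω G w x := by
    intro w hw x
    by_cases hx : x ∈ Ω
    · rw [ext0_in hx, indicator_of_mem hx]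
      have h1 := hGu (w x) (hw x hx).le
      have h2 := hGl (w x) (hw x hx).le
      exact ⟨h1.1, h1.2, by linarith⟩
    · rw [ext0_out hx, indicator_of_notMem hx]
      norm_num
  have avT : ∀ w : EuclideanSpace ℝ (Fin n) → ℝ, (∀ x ∈ Ω, 0 < w x) → BI (ext0 Ω G w) →
      BI (Ω.indicator w) → avg (ext0 Ω G w) x0 T ≤ (T ^ n)⁻¹ * ∫ x in Ω, w x := by
    intro w hw b1 b2
    refine (avg_scal b1.1 (fun x => (ext_nonneg w hw x).1) x0 hT0).trans ?_
    apply mul_le_mul_of_nonneg_left _ (by positivity)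
    rw [← integral_indicator hΩ.1.measurableSet]
    exact integral_mono b1.1 b2.1 fun x => (ext_nonneg w hw x).2.1
  -- bound of the averages of f(u)
  have ebound : ∀ s, 0 < s → s ≤ T → avg (Ω.indicator fun x => f (u x)) x0 s ≤
      C1 * (1 + M) * s ^ (-γ) := by
    intro s hs hsT
    set μ := s ^ (-((n:ℝ) * σ / p)) with hμ
    have μp : 0 < μ := by positivity
    have hpt : ∀ x, Ω.indicator (fun x => f (u x)) x ≤ Cσ * (1 + M) * μ +
        (Cσ * (1 + M) * μ ^ (1 - p / σ)) * Ω.indicator (fun x => f (u x) ^ p) x := by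
      intro x
      by_cases hx : x ∈ Ω
      · rw [indicator_of_mem hx, indicator_of_mem hx]
        have hu := h.upos x hx
        have ft := hf_pos hf hu.le
        have h1 := hfs (u x) hu
        have h2 := rpow_young hσ hσp μp ft.le
        have h3 := hmax x hx
        calc f (u x) ≤ Cσ * (1 + u x) * f (u x) ^ σ := h1
          _ ≤ Cσ * (1 + M) * f (u x) ^ σ := by gcongr
          _ ≤ Cσ * (1 + M) * (μ + μ ^ (1 - p / σ) * f (u x) ^ p) := by gcongr
          _ = _ := by ring
      · rw [indicator_of_notMem hx, indicator_of_notMem hx]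
        positivity
    have h1 := avg_affine bf bfp hpt x0 hs
    have h2 := avg_scal bfp.1 (fun x => indicator_nonneg (fun y hy =>
      Real.rpow_nonneg (hf_pos hf (h.upos y hy).le).le p) x) x0 hs
    rw [integral_indicator hΩ.1.measurableSet] at h2
    have h3 : avg (Ω.indicator fun x => f (u x) ^ p) x0 s ≤ (s ^ n)⁻¹ * K1 :=
      h2.trans (mul_le_mul_of_nonneg_left hI1 (by positivity))
    have e1 : μ ^ (1 - p / σ) * (s ^ n)⁻¹ = μ := by
      rw [hμ, ← Real.rpow_natCast s n, ← Real.rpow_neg hs.le, ← Real.rpow_mul hs.le,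
        ← Real.rpow_add hs]
      congr 1
      field_simp
      ring
    have e2 : μ ≤ s ^ (-γ) :=
      Real.rpow_le_rpow_of_exponent_ge hs (hsT.trans hT1) (by linarith)
    calc _ ≤ _ := h1
      _ ≤ Cσ * (1 + M) * μ * c0 + Cσ * (1 + M) * μ ^ (1 - p / σ) * ((s ^ n)⁻¹ * K1) := by
          gcongr
      _ = Cσ * (1 + M) * μ * c0 + Cσ * (1 + M) * (μ ^ (1 - p / σ) * (s ^ n)⁻¹) * K1 := by ring
      _ = C1 * (1 + M) * μ := by rw [e1]; ring
      _ ≤ _ := by gcongr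
  have hD0 : 0 ≤ L * (C1 * (1 + M)) := by positivity
  have key := ode_bound (m := avg (ext0 Ω G V) x0) (A := avg (ext0 Ω G u) x0)
    (m' := fun s => s * avg (lap (ext0 Ω G V)) x0 s)
    (A' := fun s => s * avg (lap (ext0 Ω G u)) x0 s) (L := L) (D := L * (C1 * (1 + M)))
    (γ := γ) (T := T) (k := 2 * c0) hLp.le hD0 hγ2 hγ4 hT0
    (fun s => heat_deriv cV kV x0 s) (fun s => heat_deriv cU kU x0 s)
    (by
      intro s hs hsT
      have h1 := lap_ext_ge hΩ hGc hz hG1 hG2 h.Vcd h.Vb hLp.le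
        (fun x hx => (hf_pos hf (h.upos x hx).le).le) h.lapV
      have h2 := avg_lower bf (lapBI cV kV) h1 x0 hs
      have h3 := mul_le_mul_of_nonneg_left (ebound s hs hsT) hLp.le
      have h4 : s * (-(L * (C1 * (1 + M) * s ^ (-γ)))) ≤ s * avg (lap (ext0 Ω G V)) x0 s :=
        mul_le_mul_of_nonneg_left (by linarith) hs.le
      have e : s ^ (1 - γ) = s * s ^ (-γ) := by
        rw [show 1 - γ = 1 + (-γ) by ring, Real.rpow_add hs, Real.rpow_one]
      rw [e]
      linarith)
    (by
      intro s hs hsT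
      have h1 := lap_ext_ge hΩ hGc hz hG1 hG2 h.ucd h.ub hLp.le
        (fun x hx => (h.Vpos x hx).le) (fun x _ => h.lapu x)
      have h2 := avg_lower bV (lapBI cU kU) h1 x0 hs
      have h3 := avg_affine bV bVe (fun x => (ext_nonneg V h.Vpos x).2.2) x0 hs
      rw [one_mul] at h3
      have h5 := mul_le_mul_of_nonneg_left h3 hLp.le
      have h4 : s * (-(L * (2 * c0 + avg (ext0 Ω G V) x0 s))) ≤ s * avg (lap (ext0 Ω G u)) x0 s :=
        mul_le_mul_of_nonneg_left (by linarith) hs.le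
      linarith)
  have hmT0 : 0 ≤ avg (ext0 Ω G V) x0 T :=
    integral_nonneg fun z => mul_nonneg (ext_nonneg V h.Vpos _).1 (gb_pos _ z).le
  have hA0 : avg (ext0 Ω G u) x0 0 = G M * c0 := by
    unfold avg
    simp only [zero_smul, add_zero, ext0_in hx0Ω]
    rw [integral_const_mul]
  have hGM := hGl M hMp.le
  have hAT : avg (ext0 Ω G u) x0 T ≤ |(T ^ n)⁻¹ * K3| :=
    (avT u h.upos bUe bu).trans ((mul_le_mul_of_nonneg_left hI3 (by positivity)).trans (le_abs_self _))
  have hmT : avg (ext0 Ω G V) x0 T ≤ |(T ^ n)⁻¹ * K2| :=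
    (avT V h.Vpos bVe bV).trans ((mul_le_mul_of_nonneg_left hI2 (by positivity)).trans (le_abs_self _))
  rw [hA0] at key
  have hT2 : T ^ 2 / 2 ≤ 1 := by nlinarith
  have q1 : L * (2 * c0 + avg (ext0 Ω G V) x0 T) * T ^ 2 / 2 ≤
      Λ * (2 * c0 + |(T ^ n)⁻¹ * K2|) := by
    calc L * (2 * c0 + avg (ext0 Ω G V) x0 T) * T ^ 2 / 2
        = L * (2 * c0 + avg (ext0 Ω G V) x0 T) * (T ^ 2 / 2) := by ring
      _ ≤ Λ * (2 * c0 + |(T ^ n)⁻¹ * K2|) * 1 := by gcongr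
      _ = _ := by ring
  have q2 : L * (L * (C1 * (1 + M))) / ((γ - 2) * (4 - γ)) * T ^ (4 - γ) ≤ c0 / 2 * (1 + M) := by
    calc L * (L * (C1 * (1 + M))) / ((γ - 2) * (4 - γ)) * T ^ (4 - γ)
        ≤ Λ * (Λ * (C1 * (1 + M))) / ((γ - 2) * (4 - γ)) * T ^ (4 - γ) := by gcongr
      _ = H * T ^ (4 - γ) * (1 + M) := by rw [hH]; ring
      _ ≤ _ := by gcongr
  have q3 : (M - 2) * c0 ≤ G M * c0 := by gcongr
  have q4 : M * (c0 / 2) ≤ |(T ^ n)⁻¹ * K3| + Λ * (2 * c0 + |(T ^ n)⁻¹ * K2|) + c0 / 2 + 2 * c0 := by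
    linarith
  have q5 := mul_le_mul_of_nonneg_right q4 (show 0 ≤ 2 / c0 by positivity)
  have e5 : M * (c0 / 2) * (2 / c0) = M := by field_simp
  rw [e5] at q5
  exact q5

end SupPart


/-- **Corollary 1.2.** For a regular nonlinearity `f` (i.e. `a_f = ∞`) satisfying (H) with
`0 < τ₋ ≤ τ₊ < 2`, if `n < ((4α*(2−τ₊)+2τ₊)/τ₊)·max{1,τ₊}` then the extremal solution
`u* = lim_{λ↑λ*} u_λ` of `(N_λ)` is in `L^∞(Ω)`. -/
theorem statement3 {n : ℕ} (Ω : Set (EuclideanSpace ℝ (Fin n))) (hΩ : GoodDomain Ω)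
    (f : ℝ → ℝ) (hf : HypH ⊤ f)
    (hτm : 0 < tauMinus ⊤ f) (hττ : tauMinus ⊤ f ≤ tauPlus ⊤ f) (hτp : tauPlus ⊤ f < 2)
    (lamstar : ℝ) (hls : 0 < lamstar)
    (uf : ℝ → EuclideanSpace ℝ (Fin n) → ℝ)
    (hsol : ∀ lam ∈ Ioo (0:ℝ) lamstar, Solves Ω ⊤ lam f (uf lam))
    (hmin : ∀ lam ∈ Ioo (0:ℝ) lamstar, ∀ v, Solves Ω ⊤ lam f v → ∀ x ∈ Ω, uf lam x ≤ v x)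
    (hsemi : ∀ lam ∈ Ioo (0:ℝ) lamstar, Semistable Ω lam f (uf lam))
    (hstab : ∀ lam ∈ Ioo (0:ℝ) lamstar, StabIneq Ω lam f (uf lam))
    (hmono : ∀ lam₁ ∈ Ioo (0:ℝ) lamstar, ∀ lam₂ ∈ Ioo (0:ℝ) lamstar, lam₁ < lam₂ →
      ∀ x ∈ Ω, uf lam₁ x < uf lam₂ x)
    (ustar : EuclideanSpace ℝ (Fin n) → ℝ)
    (hlim : ∀ x ∈ Ω, Filter.Tendsto (fun lam => uf lam x) (nhdsWithin lamstar (Set.Iio lamstar))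
      (nhds (ustar x)))
    (αstar : ℝ) (hroot : Pf (tauMinus ⊤ f) (tauPlus ⊤ f) αstar = 0)
    (hmax : ∀ β : ℝ, Pf (tauMinus ⊤ f) (tauPlus ⊤ f) β = 0 → β ≤ αstar)
    (hn : (n : ℝ) < (4 * αstar * (2 - tauPlus ⊤ f) + 2 * tauPlus ⊤ f) / tauPlus ⊤ f *
      max 1 (tauPlus ⊤ f)) :
    ∃ C : ℝ, ∀ x ∈ Ω, ustar x ≤ C := by
  rcases Nat.eq_zero_or_pos n with hn0 | hn0
  · subst hn0
    exact ⟨ustar 0, fun x _ => by rw [Subsingleton.elim x 0]⟩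
  obtain ⟨α, a, τ, hα, ha, ham, hpτ, hτ2, hP, hnn⟩ := choose_params n hτm hττ hτp hroot hmax hn
  have hτ0 : 0 < τ := by linarith
  obtain ⟨T1, hT1⟩ := eventually_atTop.1 (tau_ev hτm hττ ham hpτ)
  set T0 := max T1 1 with hT0
  have hT0p : 0 < T0 := lt_of_lt_of_le one_pos (le_max_right _ _)
  have hev : ∀ t ≥ T0, a ≤ f t * deriv (deriv f) t / (deriv f t) ^ 2 ∧
      f t * deriv (deriv f) t / (deriv f t) ^ 2 ≤ τ :=
    fun t ht => hT1 t ((le_max_left _ _).trans ht)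
  obtain ⟨R, hR0, hR⟩ := hΩ.2.1.exists_pos_norm_le
  have hLs : 0 < √lamstar := Real.sqrt_pos.2 hls
  obtain ⟨p, hpdef⟩ : ∃ p, p = α * (2 - τ) + τ / 2 := ⟨_, rfl⟩
  have hp1 : 1 < p := by rw [hpdef]; nlinarith
  have hcp : 0 < 1 / (4 * R ^ 2 * √lamstar) := by positivity
  obtain ⟨θ, Θ, ψ, Ψ, ρ, ε, κ, C, T, hT, hρ, hε, hε1, hκ, hθc, hΘc, hψc, hΨc, hθ0, hψ0, hΘd, hΨd,
    hkey⟩ := real_key hf hα ha (by linarith : a < τ) hτ2 hP hpdef hT0p hev hcp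
  obtain ⟨cg, hcg, hgr⟩ := real_growth hf hτ0 hT0p (fun t ht => (hev t ht).2)
  obtain ⟨Cσ, hCσ, hsig⟩ := real_sigma hf hτ0 hcg hgr
  obtain ⟨cl, hcl, hlin⟩ := real_lin hf
  obtain ⟨Ca, hCa, habs⟩ := pow_absorb one_pos hp1 one_pos
  have hσ : 0 < min 1 τ := lt_min one_pos hτ0
  have hσp : min 1 τ < p := (min_le_left _ _).trans_lt hp1
  set K := |C| * volume.real Ω / κ with hK
  have hK0 : 0 ≤ K := by positivity
  obtain ⟨B, hB⟩ := sup_bound hf hΩ hσ hσp hCσ hsig (by rw [hpdef]; exact hnn) hLs hK0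
    (K2 := K) (K3 := cl * (K + Ca * volume.real Ω))
  have hms := hΩ.1.measurableSet
  have hfin : volume Ω ≠ ⊤ := hΩ.2.1.measure_lt_top.ne
  have main : ∀ lam ∈ Ioo (0:ℝ) lamstar, ∀ x ∈ Ω, uf lam x ≤ B := by
    intro lam hlam
    obtain ⟨V, h⟩ := solP_of hf hΩ hlam.1 (hsol lam hlam)
    have hle : √lam ≤ √lamstar := Real.sqrt_le_sqrt hlam.2.le
    have hen := energy_bound hf hΩ ⟨0, hn0⟩ h (hstab lam hlam) hR0 hR hT hρ hε hε1
      (by linarith : 0 ≤ p) hθc hΘc hψc hΨc hθ0 hψ0 hΘd hΨd hkey (by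
        rw [one_div, inv_mul_le_iff₀ (by positivity), mul_one]
        gcongr)
    have n1 : 0 ≤ ∫ x in Ω, f (uf lam x) ^ p := setIntegral_nonneg hms fun x hx =>
      Real.rpow_nonneg (hf_pos hf (h.upos x hx).le).le p
    have n2 : 0 ≤ ∫ x in Ω, V x := setIntegral_nonneg hms fun x hx => (h.Vpos x hx).le
    have hCC : C * volume.real Ω ≤ |C| * volume.real Ω :=
      mul_le_mul_of_nonneg_right (le_abs_self _) measureReal_nonneg
    have b1 : (∫ x in Ω, f (uf lam x) ^ p) ≤ K := by
      rw [hK, le_div_iff₀ hκ]; nlinarith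
    have b2 : (∫ x in Ω, V x) ≤ K := by
      rw [hK, le_div_iff₀ hκ]; nlinarith
    have ip := (bc_fp hf hΩ (by linarith : 0 ≤ p) h).int hΩ
    have ic : IntegrableOn (fun _ : EuclideanSpace ℝ (Fin n) => Ca) Ω := integrableOn_const hfin
    have b3 : (∫ x in Ω, uf lam x) ≤ cl * (K + Ca * volume.real Ω) := by
      have h1 : (∫ x in Ω, uf lam x) ≤ ∫ x in Ω, cl * (f (uf lam x) ^ p + Ca) := by
        refine setIntegral_mono_on ((BC.of_cont hΩ h.ucd.continuous).int hΩ)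
          ((ip.add ic).const_mul cl) hms fun x hx => ?_
        have hu := h.upos x hx
        have h2 := hlin _ hu.le
        have h3 := habs (f (uf lam x)) (hf_pos hf hu.le).le
        rw [Real.rpow_one, one_mul] at h3
        exact h2.trans (mul_le_mul_of_nonneg_left h3 hcl.le)
      refine h1.trans ?_
      rw [integral_const_mul, integral_add ip ic, setIntegral_const, smul_eq_mul]
      apply mul_le_mul_of_nonneg_left _ hcl.le
      linarith [mul_comm Ca (volume.real Ω)]
    exact hB _ _ V h hle b1 b2 b3
  refine ⟨B, fun x hx => ?_⟩
  refine le_of_tendsto (hlim x hx) ?_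
  filter_upwards [Ioo_mem_nhdsLT hls] with lam hlam
  exact main lam hlam x hx

end
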